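/- arXiv:math/0305029 — 3 statements merged into one kernel-verified Lean document; each statement's English description precedes it below -/
import Mathlib

section
/- For X, Y ∈ ℤ*: (1) X ~ Y if and only if X⁻ ~ Y⁻; (2) the linear chains satisfy [X] ~ [Y] (as weighted graphs) if and only if X ~ Y or X ~ Y⁻. -/
/-- `Y` is a blowing-up of the finite integer sequence `X`. -/
inductive SeqBlowup : List ℤ → List ℤ → Prop
  | empty : SeqBlowup [] [-1]
  | left (x : ℤ) (l : List ℤ) : SeqBlowup (x :: l) (-1 :: (x - 1) :: l)
  | mid (A B : List ℤ) (a b : ℤ) :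
      SeqBlowup (A ++ a :: b :: B) (A ++ (a - 1) :: -1 :: (b - 1) :: B)
  | right (l : List ℤ) (x : ℤ) : SeqBlowup (l ++ [x]) (l ++ [x - 1, -1])

/-- Two sequences are equivalent if one is obtained from the other by a finite
sequence of blowings-up and blowings-down. -/
def SeqEquiv (X Y : List ℤ) : Prop := Relation.EqvGen SeqBlowup X Y

/-- A weighted graph: a finite simple graph (vertices drawn from ℕ)
with an integer weight attached to each vertex. -/
structure WGraph where
  verts : Finset ℕ
  adj : ℕ → ℕ → Bool
  symm : ∀ u v, adj u v = adj v u
  irrefl : ∀ v, adj v v = false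
  adj_mem : ∀ u v, adj u v = true → u ∈ verts ∧ v ∈ verts
  wt : ℕ → ℤ

/-- Isomorphism of weighted graphs. -/
def WGraph.Iso (G G' : WGraph) : Prop :=
  ∃ f : ℕ → ℕ, Set.BijOn f ↑G.verts ↑G'.verts ∧
    (∀ u ∈ G.verts, ∀ v ∈ G.verts, (G'.adj (f u) (f v) = G.adj u v)) ∧
    (∀ v ∈ G.verts, G'.wt (f v) = G.wt v)

/-- Degree of a vertex: its number of neighbours. -/
def WGraph.deg (G : WGraph) (v : ℕ) : ℕ :=
  (G.verts.filter (fun u => G.adj v u)).card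

/-- `G'` is the blowing-up of `G` at the vertex `v`, with created vertex `e`:
`e` gets weight `-1` and is joined to `v`, and the weight of `v` drops by `1`. -/
def IsVertexBlowup (G G' : WGraph) (v e : ℕ) : Prop :=
  v ∈ G.verts ∧ e ∉ G.verts ∧
  G'.verts = insert e G.verts ∧
  (∀ a b, G'.adj a b = true ↔
    (G.adj a b = true ∨ (a = e ∧ b = v) ∨ (a = v ∧ b = e))) ∧
  G'.wt e = -1 ∧ G'.wt v = G.wt v - 1 ∧
  (∀ a ∈ G.verts, a ≠ v → G'.wt a = G.wt a)

/-- `G'` is the blowing-up of `G` at the edge `{v₁, v₂}`, with created vertex `e`: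
the edge `{v₁,v₂}` is removed, `e` gets weight `-1` and is joined to `v₁` and `v₂`,
and the weights of `v₁`, `v₂` drop by `1`. -/
def IsEdgeBlowup (G G' : WGraph) (v₁ v₂ e : ℕ) : Prop :=
  G.adj v₁ v₂ = true ∧ e ∉ G.verts ∧
  G'.verts = insert e G.verts ∧
  (∀ a b, G'.adj a b = true ↔
    ((G.adj a b = true ∧ ¬(a = v₁ ∧ b = v₂) ∧ ¬(a = v₂ ∧ b = v₁)) ∨
     (a = e ∧ (b = v₁ ∨ b = v₂)) ∨ (b = e ∧ (a = v₁ ∨ a = v₂)))) ∧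
  G'.wt e = -1 ∧ G'.wt v₁ = G.wt v₁ - 1 ∧ G'.wt v₂ = G.wt v₂ - 1 ∧
  (∀ a ∈ G.verts, a ≠ v₁ → a ≠ v₂ → G'.wt a = G.wt a)

/-- `G'` is the free blowing-up of `G`, with created vertex `e`: the disjoint union
of `G` and an isolated vertex `e` of weight `-1`. -/
def IsFreeBlowup (G G' : WGraph) (e : ℕ) : Prop :=
  e ∉ G.verts ∧ G'.verts = insert e G.verts ∧
  (∀ a b, G'.adj a b = G.adj a b) ∧
  G'.wt e = -1 ∧ (∀ a ∈ G.verts, G'.wt a = G.wt a)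

/-- `G'` is a blowing-up of `G`. -/
def WBlowup (G G' : WGraph) : Prop :=
  (∃ v e, IsVertexBlowup G G' v e) ∨ (∃ v₁ v₂ e, IsEdgeBlowup G G' v₁ v₂ e) ∨
  (∃ e, IsFreeBlowup G G' e)

/-- Equivalence of weighted graphs: generated by blowings-up, blowings-down and
isomorphisms of weighted graphs (graphs are considered up to isomorphism). -/
def WEquiv : WGraph → WGraph → Prop :=
  Relation.EqvGen (fun G G' => WBlowup G G' ∨ WGraph.Iso G G')

/-- The linear chain `[x₁, …, x_q]` associated with a sequence of integers:
consecutive vertices `0, 1, …, q-1` of weights `x₁, …, x_q`. -/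
def chainGraph (X : List ℤ) : WGraph where
  verts := Finset.range X.length
  adj := fun i j => decide (i < X.length ∧ j < X.length ∧ (i + 1 = j ∨ j + 1 = i))
  symm := by intro u v; simp only [decide_eq_decide]; omega
  irrefl := by intro v; simp only [decide_eq_false_iff_not]; omega
  adj_mem := by
    intro u v h
    simp only [decide_eq_true_eq] at h
    simp only [Finset.mem_range]
    omega
  wt := fun i => if h : i < X.length then X.get ⟨i, h⟩ else 0

/-- A weighted graph is a linear chain if it is isomorphic to `[X]` for some
finite sequence of integers `X`. -/
def IsLinearChain (G : WGraph) : Prop := ∃ X : List ℤ, WGraph.Iso G (chainGraph X)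

/-! ### Sequences -/

/-- Equivalence of sequences up to reversal. -/
def SeqEquivRev (X Y : List ℤ) : Prop := SeqEquiv X Y ∨ SeqEquiv X Y.reverse

theorem SeqEquiv.refl (X : List ℤ) : SeqEquiv X X := Relation.EqvGen.refl X

theorem SeqEquiv.symm {X Y : List ℤ} (h : SeqEquiv X Y) : SeqEquiv Y X :=
  Relation.EqvGen.symm _ _ h

theorem SeqEquiv.trans {X Y Z : List ℤ} (h : SeqEquiv X Y) (h' : SeqEquiv Y Z) : SeqEquiv X Z :=
  Relation.EqvGen.trans _ _ _ h h'

theorem SeqBlowup.seqEquiv {X Y : List ℤ} (h : SeqBlowup X Y) : SeqEquiv X Y :=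
  Relation.EqvGen.rel _ _ h

theorem SeqBlowup.reverse {X Y : List ℤ} (h : SeqBlowup X Y) :
    SeqBlowup X.reverse Y.reverse := by
  cases h with
  | empty => exact .empty
  | left x l => simpa using SeqBlowup.right l.reverse x
  | mid A B a b => simpa using SeqBlowup.mid B.reverse A.reverse b a
  | right l x => simpa using SeqBlowup.left x l.reverse

theorem SeqEquiv.reverse {X Y : List ℤ} (h : SeqEquiv X Y) :
    SeqEquiv X.reverse Y.reverse := by
  induction h with
  | rel _ _ h => exact h.reverse.seqEquiv
  | refl => exact .refl _
  | symm _ _ _ ih => exact ih.symm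
  | trans _ _ _ _ _ ih ih' => exact ih.trans ih'

theorem seqEquiv_reverse_iff {X Y : List ℤ} :
    SeqEquiv X Y ↔ SeqEquiv X.reverse Y.reverse :=
  ⟨.reverse, fun h => by simpa using h.reverse⟩

theorem SeqEquivRev.refl (X : List ℤ) : SeqEquivRev X X := .inl (.refl X)

theorem SeqEquivRev.reverse_left {X Y : List ℤ} (h : SeqEquivRev X Y) :
    SeqEquivRev X.reverse Y := by
  rcases h with h | h
  · exact .inr h.reverse
  · exact .inl (by simpa using h.reverse)

theorem SeqEquivRev.of_seqEquiv_left {X Y Z : List ℤ} (h : SeqEquiv X Y)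
    (h' : SeqEquivRev Y Z) : SeqEquivRev X Z :=
  h'.imp h.trans h.trans

/-- Add `k` to the first term of a sequence. -/
def bumpHead (k : ℤ) : List ℤ → List ℤ
  | [] => []
  | a :: l => (a + k) :: l

/-- Add `k` to the last term of a sequence. -/
def bumpLast (k : ℤ) (l : List ℤ) : List ℤ := (bumpHead k l.reverse).reverse

@[simp] theorem bumpHead_nil (k : ℤ) : bumpHead k [] = [] := rfl
@[simp] theorem bumpHead_cons (k a : ℤ) (l : List ℤ) : bumpHead k (a :: l) = (a + k) :: l := rfl
@[simp] theorem bumpHead_zero (l : List ℤ) : bumpHead 0 l = l := by cases l <;> simp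
@[simp] theorem bumpLast_nil (k : ℤ) : bumpLast k [] = [] := rfl
@[simp] theorem bumpLast_concat (k a : ℤ) (l : List ℤ) :
    bumpLast k (l ++ [a]) = l ++ [a + k] := by simp [bumpLast]
@[simp] theorem bumpLast_zero (l : List ℤ) : bumpLast 0 l = l := by simp [bumpLast]
@[simp] theorem reverse_bumpHead (k : ℤ) (l : List ℤ) :
    (bumpHead k l).reverse = bumpLast k l.reverse := by simp [bumpLast]
@[simp] theorem reverse_bumpLast (k : ℤ) (l : List ℤ) :
    (bumpLast k l).reverse = bumpHead k l.reverse := by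
  rw [bumpLast, List.reverse_reverse]

/-- `L` may be replaced by `L'` inside every sequence, at the price of adding `k` to the term
preceding it and `j` to the term following it (when these exist). -/
def SegEquiv (k j : ℤ) (L L' : List ℤ) : Prop :=
  ∀ P Q : List ℤ, SeqEquiv (P ++ L ++ Q) (bumpLast k P ++ L' ++ bumpHead j Q)

theorem SegEquiv.seqEquiv {k j : ℤ} {L L' : List ℤ} (h : SegEquiv k j L L') : SeqEquiv L L' := by
  simpa using h [] []

theorem SegEquiv.cons {k j : ℤ} {L L' : List ℤ} (h : SegEquiv k j L L') (a : ℤ) :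
    SegEquiv 0 j (a :: L) ((a + k) :: L') := fun P Q => by
  simpa using h (P ++ [a]) Q

theorem SegEquiv.reverse {k j : ℤ} {L L' : List ℤ} (h : SegEquiv k j L L') :
    SegEquiv j k L.reverse L'.reverse := fun P Q => by
  simpa using (h Q.reverse P.reverse).reverse

theorem SegEquiv.symm {k j : ℤ} {L L' : List ℤ} (h : SegEquiv k j L L') :
    SegEquiv (-k) (-j) L' L := fun P Q => by
  have := (h (bumpLast (-k) P) (bumpHead (-j) Q)).symm
  have h1 : bumpLast k (bumpLast (-k) P) = P := by
    rcases P.eq_nil_or_concat' with rfl | ⟨l, a, rfl⟩ <;> simp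
  have h2 : bumpHead j (bumpHead (-j) Q) = Q := by cases Q <;> simp
  rwa [h1, h2] at this

theorem SegEquiv.left (x : ℤ) (l : List ℤ) : SegEquiv (-1) 0 (x :: l) (-1 :: (x - 1) :: l) := by
  intro P Q
  rcases P.eq_nil_or_concat' with rfl | ⟨P, a, rfl⟩
  · simpa using (SeqBlowup.left x (l ++ Q)).seqEquiv
  · simpa [sub_eq_add_neg] using (SeqBlowup.mid P (l ++ Q) a x).seqEquiv

theorem SegEquiv.right (x : ℤ) (l : List ℤ) : SegEquiv 0 (-1) (l ++ [x]) (l ++ [x - 1, -1]) := by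
  simpa using (SegEquiv.left x l.reverse).reverse

theorem SegEquiv.mid (A B : List ℤ) (a b : ℤ) :
    SegEquiv 0 0 (A ++ a :: b :: B) (A ++ (a - 1) :: -1 :: (b - 1) :: B) := by
  intro P Q
  simpa using (SeqBlowup.mid (P ++ A) (B ++ Q) a b).seqEquiv

/-! ### Consecutive elements of a list -/

/-- The number of places of the list where `x` and `y` are consecutive, in either order. -/
def link : List ℕ → ℕ → ℕ → ℤ
  | a :: b :: t, x, y =>
    (if (x = a ∧ y = b) ∨ (x = b ∧ y = a) then 1 else 0) + link (b :: t) x y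
  | _, _, _ => 0

@[simp] theorem link_nil (x y : ℕ) : link [] x y = 0 := rfl
@[simp] theorem link_singleton (a x y : ℕ) : link [a] x y = 0 := rfl
@[simp] theorem link_cons_cons (a b : ℕ) (t : List ℕ) (x y : ℕ) : link (a :: b :: t) x y =
    (if (x = a ∧ y = b) ∨ (x = b ∧ y = a) then 1 else 0) + link (b :: t) x y := rfl

theorem link_append (p : List ℕ) (u : ℕ) (q : List ℕ) (x y : ℕ) :
    link (p ++ u :: q) x y = link (p ++ [u]) x y + link (u :: q) x y := by
  induction p with
  | nil => simp
  | cons a p ih =>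
    cases p with
    | nil => simp
    | cons b p => simp only [List.cons_append, link_cons_cons] at ih ⊢; rw [ih]; ring

theorem link_nonneg (s : List ℕ) (x y : ℕ) : 0 ≤ link s x y := by
  induction s with
  | nil => simp
  | cons a s ih =>
    cases s with
    | nil => simp
    | cons b s => rw [link_cons_cons]; split_ifs <;> omega

theorem link_comm (s : List ℕ) (x y : ℕ) : link s x y = link s y x := by
  induction s with
  | nil => simp
  | cons a s ih =>
    cases s with
    | nil => simp
    | cons b s => rw [link_cons_cons, link_cons_cons, ih]; congr 1; apply if_congr <;> tauto

theorem link_reverse (s : List ℕ) (x y : ℕ) : link s.reverse x y = link s x y := by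
  induction s with
  | nil => simp
  | cons a s ih =>
    cases s with
    | nil => simp
    | cons b s =>
      have := link_append s.reverse b [a] x y
      simp only [List.reverse_cons, List.append_assoc, List.cons_append, List.nil_append] at ih ⊢
      rw [this, ih, link_cons_cons, link_cons_cons, link_singleton, add_zero, add_comm]
      congr 1; apply if_congr <;> tauto

theorem link_of_notMem {s : List ℕ} {x : ℕ} (h : x ∉ s) (y : ℕ) : link s x y = 0 := by
  induction s with
  | nil => simp
  | cons a s ih =>
    cases s with
    | nil => simp
    | cons b s => simp only [List.mem_cons, not_or] at h ih; simp [h, ih]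

theorem link_map {s : List ℕ} {f : ℕ → ℕ} (hf : Set.InjOn f {a | a ∈ s}) {x y : ℕ}
    (hx : x ∈ s) (hy : y ∈ s) : link (s.map f) (f x) (f y) = link s x y := by
  have key : ∀ t : List ℕ, (∀ a ∈ t, a ∈ s) → link (t.map f) (f x) (f y) = link t x y := by
    intro t
    induction t with
    | nil => simp
    | cons a t ih =>
      cases t with
      | nil => simp
      | cons b t =>
        intro h
        have ha : a ∈ s := h a (by simp)
        have hb : b ∈ s := h b (by simp)
        have := ih fun c hc => h c (by simp [hc])
        simp only [List.map_cons, link_cons_cons] at this ⊢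
        simp only [this, hf.eq_iff hx ha, hf.eq_iff hx hb, hf.eq_iff hy ha, hf.eq_iff hy hb]
  exact key s fun _ h => h

theorem link_split {p q : List ℕ} {x : ℕ} (h : (p ++ x :: q).Nodup) (y : ℕ) :
    link (p ++ x :: q) x y =
      (if p.getLast? = some y then 1 else 0) + (if q.head? = some y then 1 else 0) := by
  rw [link_append]
  congr 1
  · rcases p.eq_nil_or_concat' with rfl | ⟨p, u, rfl⟩
    · simp
    · have h1 : x ∉ p ++ [u] := by
        have := (List.nodup_append.1 h).2.2
        intro hx
        exact this x hx x (by simp) rfl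
      rw [List.append_assoc]
      simp only [List.cons_append, List.nil_append]
      rw [link_append, link_of_notMem h1]
      simp only [List.mem_append, List.mem_singleton, not_or] at h1
      simp [h1, eq_comm]
  · cases q with
    | nil => simp
    | cons v q =>
      have h1 : x ∉ v :: q := (List.nodup_cons.1 (List.nodup_append.1 h).2.1).1
      rw [link_cons_cons, link_of_notMem h1]
      simp only [List.mem_cons, not_or] at h1
      simp [h1, eq_comm]

theorem link_remove {p q : List ℕ} {x y z : ℕ} (h : (p ++ x :: q).Nodup)
    (hy : y ≠ x) (hz : z ≠ x) (hyz : y ≠ z) :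
    link (p ++ q) y z =
      link (p ++ x :: q) y z + link (p ++ x :: q) x y * link (p ++ x :: q) x z := by
  rw [link_split h, link_split h]
  rcases p.eq_nil_or_concat' with rfl | ⟨p, u, rfl⟩
  · cases q with
    | nil => simp
    | cons v q => simp [hy, hz]; grind
  · cases q with
    | nil =>
      have := link_append p u [x] y z
      simp [this, hy, hz]; grind
    | cons v q =>
      have h1 := link_append p u (x :: v :: q) y z
      have h2 := link_append p u (v :: q) y z
      simp only [List.append_assoc, List.cons_append, List.nil_append]
      rw [h1, h2]
      simp [hy, hz]; grind

/-! ### Weighted graphs as symmetric integer matrices -/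

/-- The result of blowing down the vertex `e` of a weighted graph given by its matrix `M`: the
diagonal of `M` records the weights and the other entries the edges. -/
def contr (M : ℕ → ℕ → ℤ) (e : ℕ) : ℕ → ℕ → ℤ := fun a b => M a b + M e a * M e b

/-- The vertex `e` is joined to at most two vertices of `V`, by simple edges. -/
def SmallDegree (V : Finset ℕ) (M : ℕ → ℕ → ℤ) (e : ℕ) : Prop :=
  (∀ a ∈ V, a ≠ e → M e a = 0 ∨ M e a = 1) ∧
  ∀ a ∈ V, ∀ b ∈ V, ∀ c ∈ V, a ≠ e → b ≠ e → c ≠ e →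
    M e a = 1 → M e b = 1 → M e c = 1 → a = b ∨ a = c ∨ b = c

/-- The vertex `e` can be blown down. -/
def Contractible (V : Finset ℕ) (M : ℕ → ℕ → ℤ) (e : ℕ) : Prop :=
  e ∈ V ∧ M e e = -1 ∧ SmallDegree V M e

/-- The vertices in the list `s` form, in this order, a linear chain. -/
def IsPath (M : ℕ → ℕ → ℤ) (s : List ℕ) : Prop :=
  s.Nodup ∧ ∀ x ∈ s, ∀ y ∈ s, x ≠ y → M x y = link s x y

/-- The weights of the vertices in the list `s`. -/
def weights (M : ℕ → ℕ → ℤ) (s : List ℕ) : List ℤ := s.map fun x => M x x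

/-- The weighted graph with vertices `V` and matrix `M` can be blown down to a linear chain whose
sequence of weights is equivalent to `X` up to reversal. -/
inductive Reduces (X : List ℤ) : Finset ℕ → (ℕ → ℕ → ℤ) → Prop
  | path {V : Finset ℕ} {M : ℕ → ℕ → ℤ} (s : List ℕ) (hV : V = s.toFinset) (hs : IsPath M s)
      (hX : SeqEquivRev (weights M s) X) : Reduces X V M
  | step {V : Finset ℕ} {M : ℕ → ℕ → ℤ} (e : ℕ) (he : Contractible V M e)
      (h : Reduces X (V.erase e) (contr M e)) : Reduces X V M

@[simp] theorem weights_nil (M : ℕ → ℕ → ℤ) : weights M [] = [] := rfl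
@[simp] theorem weights_cons (M : ℕ → ℕ → ℤ) (a : ℕ) (s : List ℕ) :
    weights M (a :: s) = M a a :: weights M s := rfl
@[simp] theorem weights_append (M : ℕ → ℕ → ℤ) (s t : List ℕ) :
    weights M (s ++ t) = weights M s ++ weights M t := by simp [weights]
@[simp] theorem weights_reverse (M : ℕ → ℕ → ℤ) (s : List ℕ) :
    weights M s.reverse = (weights M s).reverse := by simp [weights]

theorem contr_symm {M : ℕ → ℕ → ℤ} (h : ∀ a b, M a b = M b a) (e a b : ℕ) :
    contr M e a b = contr M e b a := by simp only [contr, h a b, mul_comm]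

theorem contr_eq_of_eq_zero {M : ℕ → ℕ → ℤ} {e a : ℕ} (h : M e a = 0) (b : ℕ) :
    contr M e a b = M a b := by simp [contr, h]

theorem contr_comm {M : ℕ → ℕ → ℤ} (hM : ∀ a b, M a b = M b a) {e f : ℕ} (h : M e f = 0) :
    contr (contr M e) f = contr (contr M f) e := by
  have h' : M f e = 0 := hM e f ▸ h
  funext a b
  simp only [contr, h, h', zero_mul, add_zero]
  ring

theorem weights_contr {M : ℕ → ℕ → ℤ} {e : ℕ} {s : List ℕ} (h : ∀ x ∈ s, M e x = 0) :
    weights (contr M e) s = weights M s :=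
  List.map_congr_left fun x hx => contr_eq_of_eq_zero (h x hx) x

theorem SmallDegree.mono {V W : Finset ℕ} {M : ℕ → ℕ → ℤ} {e : ℕ} (h : SmallDegree V M e)
    (hW : W ⊆ V) : SmallDegree W M e :=
  ⟨fun a ha => h.1 a (hW ha),
    fun a ha b hb c hc => h.2 a (hW ha) b (hW hb) c (hW hc)⟩

theorem Contractible.erase_contr {V : Finset ℕ} {M : ℕ → ℕ → ℤ} {e f : ℕ}
    (h : Contractible V M e) (hne : e ≠ f) (hef : M f e = 0) :
    Contractible (V.erase f) (contr M f) e := by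
  have h1 : ∀ a, contr M f e a = M e a := contr_eq_of_eq_zero hef
  refine ⟨Finset.mem_erase.2 ⟨hne, h.1⟩, by rw [h1]; exact h.2.1, ?_⟩
  have := h.2.2.mono (V.erase_subset f)
  simpa only [SmallDegree, h1] using this

theorem IsPath.link_left {M : ℕ → ℕ → ℤ} {p q : List ℕ} {x y : ℕ} (h : IsPath M (p ++ x :: q))
    (hy : y ∈ p ++ x :: q) (hne : y ≠ x) : M x y =
      (if p.getLast? = some y then 1 else 0) + (if q.head? = some y then 1 else 0) := by
  rw [h.2 x (by simp) y hy hne.symm, link_split h.1]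

theorem IsPath.reverse {M : ℕ → ℕ → ℤ} {s : List ℕ} (h : IsPath M s) : IsPath M s.reverse :=
  ⟨by simpa using h.1, fun x hx y hy hxy => by
    rw [link_reverse]; exact h.2 x (by simpa using hx) y (by simpa using hy) hxy⟩

theorem IsPath.contr {M : ℕ → ℕ → ℤ} {p q : List ℕ} {g : ℕ} (h : IsPath M (p ++ g :: q)) :
    IsPath (contr M g) (p ++ q) := by
  have hs := h.1
  have hg : ∀ x ∈ p ++ q, x ≠ g ∧ x ∈ p ++ g :: q := by
    intro x hx
    constructor
    · rintro rfl
      exact (List.nodup_middle.1 hs |> List.nodup_cons.1).1 hx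
    · simp at hx ⊢; tauto
  refine ⟨(List.nodup_cons.1 (List.nodup_middle.1 hs)).2, fun x hx y hy hxy => ?_⟩
  obtain ⟨h1, h2⟩ := hg x hx
  obtain ⟨h3, h4⟩ := hg y hy
  have hgm : g ∈ p ++ g :: q := by simp
  rw [_root_.contr, link_remove hs h1 h3 hxy, h.2 x h2 y h4 hxy, h.2 g hgm x h2 h1.symm,
    h.2 g hgm y h4 h3.symm]

theorem IsPath.smallDegree {M : ℕ → ℕ → ℤ} {s : List ℕ} (h : IsPath M s) {x : ℕ} (hx : x ∈ s) :
    SmallDegree s.toFinset M x := by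
  obtain ⟨p, q, rfl⟩ := List.append_of_mem hx
  have key : ∀ a ∈ (p ++ x :: q).toFinset, a ≠ x → M x a =
      (if p.getLast? = some a then 1 else 0) + (if q.head? = some a then 1 else 0) :=
    fun a ha => h.link_left (List.mem_toFinset.1 ha)
  constructor
  · intro a ha hax
    rw [key a ha hax]
    by_cases h1 : p.getLast? = some a
    · have h2 : ¬ q.head? = some a := fun h2 => by
        have h3 : a ∈ p := List.mem_of_getLast? h1
        have h4 : a ∈ q := List.mem_of_head? h2
        exact (List.nodup_append.1 h.1).2.2 a h3 a (by simp [h4]) rfl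
      simp [h1, h2]
    · simp only [h1, if_false, zero_add]; split_ifs <;> simp
  · intro a ha b hb c hc hax hbx hcx
    rw [key a ha hax, key b hb hbx, key c hc hcx]
    grind

/-- Blowing down a vertex of a linear chain with at least two vertices changes its sequence of
weights as a blowing-down of sequences does. -/
theorem IsPath.weights_contr {M : ℕ → ℕ → ℤ} {p q : List ℕ} {g : ℕ}
    (h : IsPath M (p ++ g :: q)) (hg : M g g = -1) (hne : p ++ q ≠ []) :
    SegEquiv (if p = [] then 1 else 0) (if q = [] then 1 else 0)
      (weights M (p ++ g :: q)) (weights (_root_.contr M g) (p ++ q)) := by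
  have hs := h.1
  have hmem : ∀ x, x ∈ p ∨ x ∈ q → x ∈ p ++ g :: q := by
    intro x hx; simp; tauto
  have hgn : ∀ x, x ∈ p ∨ x ∈ q → x ≠ g := by
    rintro x hx rfl
    exact (List.nodup_middle.1 hs |> List.nodup_cons.1).1 (by simpa using hx)
  have key := fun x hx => h.link_left (hmem x hx) (hgn x hx)
  have hdisj : ∀ x ∈ p, x ∉ q := fun x hx hx' =>
    (List.nodup_append.1 hs).2.2 x hx x (by simp [hx']) rfl
  have hp := (List.nodup_append.1 hs).1
  have hq := (List.nodup_cons.1 (List.nodup_append.1 hs).2.1).2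
  have hQ : ∀ v t, q = v :: t → weights (_root_.contr M g) q = (M v v + 1) :: weights M t := by
    rintro v t rfl
    have hv : M g v = 1 := by
      have : p.getLast? ≠ some v := fun h' => hdisj v (List.mem_of_getLast? h') (by simp)
      rw [key v (by simp)]; simp [this]
    have ht : ∀ x ∈ t, M g x = 0 := by
      intro x hx
      have h1 : p.getLast? ≠ some x := fun h' => hdisj x (List.mem_of_getLast? h') (by simp [hx])
      have h2 : v ≠ x := by rintro rfl; exact (List.nodup_cons.1 hq).1 hx
      rw [key x (by simp [hx])]; simp [h1, h2]
    rw [weights_cons, _root_.weights_contr ht, _root_.contr, hv]; simp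
  have hP : ∀ u t, p = t ++ [u] → weights (_root_.contr M g) p = weights M t ++ [M u u + 1] := by
    rintro u t rfl
    have hu : M g u = 1 := by
      have : q.head? ≠ some u := fun h' => hdisj u (by simp) (List.mem_of_head? h')
      rw [key u (by simp)]; simp [this]
    have ht : ∀ x ∈ t, M g x = 0 := by
      intro x hx
      have h1 : q.head? ≠ some x := fun h' => hdisj x (by simp [hx]) (List.mem_of_head? h')
      have h2 : u ≠ x := by
        rintro rfl; exact (List.nodup_append.1 hp).2.2 u hx u (by simp) rfl
      rw [key x (by simp [hx])]; simp [h1, h2]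
    rw [weights_append, _root_.weights_contr ht, weights_cons, _root_.contr, hu]; simp
  rcases p.eq_nil_or_concat' with rfl | ⟨t, u, rfl⟩
  · cases q with
    | nil => simp at hne
    | cons v t =>
      simpa [hQ v t rfl, hg] using (SegEquiv.left (M v v + 1) (weights M t)).symm
  · cases q with
    | nil =>
      rw [List.append_nil, hP u t rfl]
      simpa [hg] using (SegEquiv.right (M u u + 1) (weights M t)).symm
    | cons v t' =>
      rw [weights_append (_root_.contr M g), hP u t rfl, hQ v t' rfl]
      simpa [hg] using
        (SegEquiv.mid (weights M t) (weights M t') (M u u + 1) (M v v + 1)).symm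

theorem IsPath.seqEquiv_contr {M : ℕ → ℕ → ℤ} {p q : List ℕ} {g : ℕ}
    (h : IsPath M (p ++ g :: q)) (hg : M g g = -1) :
    SeqEquiv (weights M (p ++ g :: q)) (weights (_root_.contr M g) (p ++ q)) := by
  by_cases hne : p ++ q = []
  · obtain ⟨rfl, rfl⟩ := List.append_eq_nil_iff.1 hne
    simpa [hg] using SeqBlowup.empty.seqEquiv.symm
  · exact (h.weights_contr hg hne).seqEquiv

/-! ### Acyclic graphs -/

/-- Every nonempty set of vertices contains a vertex of degree at most one in it. -/
def Acyclic (V : Finset ℕ) (M : ℕ → ℕ → ℤ) : Prop :=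
  ∀ S ⊆ V, S.Nonempty → ∃ v ∈ S, ∑ u ∈ S.erase v, M v u ≤ 1

theorem link_cons_of_ne {a x y : ℕ} (hx : x ≠ a) (hy : y ≠ a) (t : List ℕ) :
    link (a :: t) x y = link t x y := by
  cases t <;> simp [hx, hy]

theorem IsPath.tail {M : ℕ → ℕ → ℤ} {a : ℕ} {t : List ℕ} (h : IsPath M (a :: t)) :
    IsPath M t := by
  have ha := List.nodup_cons.1 h.1
  refine ⟨ha.2, fun x hx y hy hxy => ?_⟩
  rw [h.2 x (by simp [hx]) y (by simp [hy]) hxy, link_cons_of_ne]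
  · rintro rfl; exact ha.1 hx
  · rintro rfl; exact ha.1 hy

theorem IsPath.acyclic {M : ℕ → ℕ → ℤ} {s : List ℕ} (h : IsPath M s) :
    Acyclic s.toFinset M := by
  induction s with
  | nil =>
    rintro S hS ⟨x, hx⟩
    simpa using hS hx
  | cons a t ih =>
    intro S hS hne
    by_cases ha : a ∈ S
    · refine ⟨a, ha, ?_⟩
      have : ∀ u ∈ S.erase a, M a u = if t.head? = some u then 1 else 0 := by
        intro u hu
        have hu' := Finset.mem_erase.1 hu
        have := IsPath.link_left (p := []) h (List.mem_toFinset.1 (hS hu'.2)) hu'.1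
        simpa using this
      rw [Finset.sum_congr rfl this]
      cases t with
      | nil => simp
      | cons v t =>
        simp only [List.head?_cons, Option.some.injEq, Finset.sum_ite_eq]
        split_ifs <;> simp
    · refine ih h.tail S (fun x hx => ?_) hne
      have := hS hx
      have hxa : x ≠ a := by rintro rfl; exact ha hx
      simpa [hxa] using this

theorem Acyclic.of_contr {V : Finset ℕ} {M : ℕ → ℕ → ℤ} {e : ℕ} (hM : ∀ a b, M a b = M b a)
    (he : Contractible V M e) (h : Acyclic (V.erase e) (contr M e)) : Acyclic V M := by
  have h01 : ∀ v ∈ V, v ≠ e → 0 ≤ M e v := fun v hv hve => by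
    rcases he.2.2.1 v hv hve with h | h <;> simp [h]
  intro S hS hne
  by_cases heS : e ∈ S
  · by_cases hdeg : ∑ u ∈ S.erase e, M e u ≤ 1
    · exact ⟨e, heS, hdeg⟩
    · have hne' : (S.erase e).Nonempty := by
        by_contra hemp
        rw [Finset.not_nonempty_iff_eq_empty] at hemp
        simp [hemp] at hdeg
      obtain ⟨v, hv, hsum⟩ := h (S.erase e) (Finset.erase_subset_erase e hS) hne'
      obtain ⟨hve, hvS⟩ := Finset.mem_erase.1 hv
      refine ⟨v, hvS, ?_⟩
      have h1 : ∑ u ∈ S.erase v, M v u = M v e + ∑ u ∈ (S.erase e).erase v, M v u := by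
        rw [Finset.erase_right_comm, Finset.add_sum_erase _ _ (Finset.mem_erase.2 ⟨hve.symm, heS⟩)]
      have h2 : M e v + ∑ u ∈ (S.erase e).erase v, M e u = ∑ u ∈ S.erase e, M e u :=
        Finset.add_sum_erase _ _ hv
      simp only [contr, Finset.sum_add_distrib, ← Finset.mul_sum] at hsum
      rw [h1, hM v e]
      rcases he.2.2.1 v (hS hvS) hve with h0 | h0 <;> rw [h0] at hsum h2 ⊢ <;> linarith
  · obtain ⟨v, hv, hsum⟩ := h S (fun x hx => Finset.mem_erase.2
      ⟨by rintro rfl; exact heS hx, hS hx⟩) hne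
    refine ⟨v, hv, le_trans (Finset.sum_le_sum fun u hu => ?_) hsum⟩
    have hu' := (Finset.mem_erase.1 hu).2
    have := mul_nonneg (h01 v (hS hv) (by rintro rfl; exact heS hv))
      (h01 u (hS hu') (by rintro rfl; exact heS hu'))
    simp only [contr]; linarith

theorem Reduces.acyclic {X : List ℤ} {V : Finset ℕ} {M : ℕ → ℕ → ℤ} (h : Reduces X V M)
    (hM : ∀ a b, M a b = M b a) : Acyclic V M := by
  induction h with
  | path s hV hs _ => subst hV; exact hs.acyclic
  | step e he _ ih => exact .of_contr hM he (ih (contr_symm hM e))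

/-! ### Graphs whose form is not negative definite -/

/-- The quadratic form of `M` is not negative definite on `S`. -/
def NotNegDef (M : ℕ → ℕ → ℤ) (S : Finset ℕ) : Prop :=
  ∃ v : ℕ → ℤ, (∃ a ∈ S, v a ≠ 0) ∧ 0 ≤ ∑ a ∈ S, ∑ b ∈ S, M a b * (v a * v b)

theorem NotNegDef.mono {M : ℕ → ℕ → ℤ} {S T : Finset ℕ} (h : NotNegDef M S) (hST : S ⊆ T) :
    NotNegDef M T := by
  obtain ⟨v, ⟨a, ha, hva⟩, hv⟩ := h
  refine ⟨fun x => if x ∈ S then v x else 0, ⟨a, hST ha, by simpa [ha] using hva⟩, hv.trans_eq ?_⟩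
  refine (Finset.sum_congr rfl fun a ha => Finset.sum_congr rfl fun b hb => ?_).trans
    ((Finset.sum_congr rfl fun a ha => Finset.sum_subset hST fun b _ hb => ?_).trans
      (Finset.sum_subset hST fun a _ ha => Finset.sum_eq_zero fun b _ => ?_))
  · simp [ha, hb]
  · simp [hb]
  · simp [ha]

theorem NotNegDef.contr {M : ℕ → ℕ → ℤ} {S : Finset ℕ} {g : ℕ} (hM : ∀ a b, M a b = M b a)
    (h : NotNegDef M S) (hg : g ∈ S) (hgg : M g g = -1) : NotNegDef (contr M g) (S.erase g) := by
  obtain ⟨v, ⟨a, ha, hva⟩, hv⟩ := h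
  set T := S.erase g with hT
  set σ := ∑ a ∈ T, M g a * v a with hσ
  have hgT : g ∉ T := by simp [hT]
  have hST : S = insert g T := by simp [hT, Finset.insert_erase hg]
  have h1 : ∑ a ∈ S, ∑ b ∈ S, M a b * (v a * v b) =
      -(v g * v g) + 2 * (v g * σ) + ∑ a ∈ T, ∑ b ∈ T, M a b * (v a * v b) := by
    simp only [hST, Finset.sum_insert hgT, Finset.sum_add_distrib]
    have e1 : ∑ b ∈ T, M g b * (v g * v b) = v g * σ := by
      rw [hσ, Finset.mul_sum]; exact Finset.sum_congr rfl fun _ _ => by ring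
    have e2 : ∑ b ∈ T, M b g * (v b * v g) = v g * σ := by
      rw [hσ, Finset.mul_sum]; exact Finset.sum_congr rfl fun b _ => by rw [hM b g]; ring
    rw [e1, e2, hgg]; ring
  have h2 : ∑ a ∈ T, ∑ b ∈ T, _root_.contr M g a b * (v a * v b) =
      ∑ a ∈ T, ∑ b ∈ T, M a b * (v a * v b) + σ * σ := by
    rw [hσ, Finset.sum_mul_sum, ← Finset.sum_add_distrib]
    refine Finset.sum_congr rfl fun a _ => ?_
    rw [← Finset.sum_add_distrib]
    exact Finset.sum_congr rfl fun b _ => by simp only [_root_.contr]; ring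
  refine ⟨v, ?_, ?_⟩
  · by_contra! hzero
    have e1 : σ = 0 := Finset.sum_eq_zero fun b hb => by rw [hzero b hb, mul_zero]
    have e2 : ∑ a ∈ T, ∑ b ∈ T, M a b * (v a * v b) = 0 :=
      Finset.sum_eq_zero fun b hb => Finset.sum_eq_zero fun c _ => by simp [hzero b hb]
    rw [h1, e1, e2] at hv
    have e3 : v g = 0 := by nlinarith
    rw [hST, Finset.mem_insert] at ha
    rcases ha with rfl | ha
    · exact hva e3
    · exact hva (hzero a ha)
  · rw [h2]; rw [h1] at hv
    nlinarith [sq_nonneg (v g - σ)]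

theorem not_notNegDef_singleton {M : ℕ → ℕ → ℤ} {g : ℕ} (hgg : M g g = -1) :
    ¬ NotNegDef M {g} := by
  rintro ⟨v, ⟨a, ha, hva⟩, hv⟩
  rw [Finset.mem_singleton] at ha
  subst ha
  simp only [Finset.sum_singleton, hgg] at hv
  exact hva (by nlinarith)

/-! ### Segments of a graph -/

/-- On `O`, the function `α` vanishes or is the indicator of an element of `O`. -/
def IsUnitOn (O : Finset ℕ) (α : ℕ → ℤ) : Prop :=
  ∀ o ∈ O, α o ≠ 0 → ∀ o' ∈ O, α o' = if o' = o then 1 else 0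

/-- The vertices of the list `s` form a linear chain attached to the vertices of `O` only through
its first element, according to `α`, and its last element, according to `β`. -/
structure IsSegment (M : ℕ → ℕ → ℤ) (O : Finset ℕ) (α β : ℕ → ℤ) (s : List ℕ) : Prop where
  path : IsPath M s
  ne : s ≠ []
  disj : ∀ x ∈ s, x ∉ O
  attach : ∀ x ∈ s, ∀ o ∈ O, M x o =
    (if s.head? = some x then α o else 0) + (if s.getLast? = some x then β o else 0)

theorem IsUnitOn.mono {O O' : Finset ℕ} {α : ℕ → ℤ} (h : IsUnitOn O α) (hO : O' ⊆ O) :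
    IsUnitOn O' α := fun o ho hα o' ho' => h o (hO ho) hα o' (hO ho')

theorem IsSegment.reverse {M : ℕ → ℕ → ℤ} {O : Finset ℕ} {α β : ℕ → ℤ} {s : List ℕ}
    (h : IsSegment M O α β s) : IsSegment M O β α s.reverse where
  path := h.path.reverse
  ne := by simpa using h.ne
  disj := by simpa using h.disj
  attach x hx o ho := by
    rw [h.attach x (by simpa using hx) o ho, add_comm]; simp

theorem IsSegment.erase {M : ℕ → ℕ → ℤ} {O : Finset ℕ} {α β : ℕ → ℤ} {s : List ℕ} {e : ℕ}
    (hM : ∀ a b, M a b = M b a) (h : IsSegment M O α β s) (he : e ∈ O) (hα : α e = 0)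
    (hβ : β e = 0) : IsSegment (contr M e) (O.erase e) α β s := by
  have h0 : ∀ x ∈ s, M e x = 0 := fun x hx => by rw [hM, h.attach x hx e he, hα, hβ]; simp
  exact
  { path := ⟨h.path.1, fun x hx y hy hxy => by
      rw [contr_eq_of_eq_zero (h0 x hx), h.path.2 x hx y hy hxy]⟩
    ne := h.ne
    disj := fun x hx hx' => h.disj x hx (Finset.mem_of_mem_erase hx')
    attach := fun x hx o ho => by
      rw [contr_eq_of_eq_zero (h0 x hx), h.attach x hx o (Finset.mem_of_mem_erase ho)] }

theorem head?_eq_some_iff_of_split {p q : List ℕ} {g : ℕ} (h : (p ++ g :: q).Nodup) :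
    (p ++ g :: q).head? = some g ↔ p = [] := by
  cases p with
  | nil => simp
  | cons a p =>
    have : a ≠ g := by rintro rfl; simp at h
    simpa using this

theorem getLast?_eq_some_iff_of_split {p q : List ℕ} {g : ℕ} (h : (p ++ g :: q).Nodup) :
    (p ++ g :: q).getLast? = some g ↔ q = [] := by
  have := head?_eq_some_iff_of_split (p := q.reverse) (q := p.reverse) (g := g)
    (by simpa using List.nodup_reverse.2 h)
  rw [← List.head?_reverse]
  simpa using this

theorem IsSegment.attach_split {M : ℕ → ℕ → ℤ} {O : Finset ℕ} {α β : ℕ → ℤ} {p q : List ℕ} {g : ℕ}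
    (h : IsSegment M O α β (p ++ g :: q)) {o : ℕ} (ho : o ∈ O) :
    M g o = (if p = [] then α o else 0) + (if q = [] then β o else 0) := by
  rw [h.attach g (by simp) o ho]
  simp only [head?_eq_some_iff_of_split h.path.1, getLast?_eq_some_iff_of_split h.path.1]

theorem IsSegment.contr {M : ℕ → ℕ → ℤ} {O : Finset ℕ} {α β : ℕ → ℤ} {p q : List ℕ} {g : ℕ}
    (h : IsSegment M O α β (p ++ g :: q)) (hne : p ++ q ≠ []) :
    IsSegment (contr M g) O α β (p ++ q) where
  path := h.path.contr
  ne := hne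
  disj x hx := h.disj x (by simp at hx ⊢; tauto)
  attach x hx o ho := by
    have hxs : x ∈ p ++ g :: q := by simp at hx ⊢; tauto
    have hxg : x ≠ g := by
      rintro rfl
      exact (List.nodup_middle.1 h.path.1 |> List.nodup_cons.1).1 hx
    rw [_root_.contr, h.attach x hxs o ho, h.attach_split ho, h.path.link_left hxs hxg]
    have hs := h.path.1
    rcases p.eq_nil_or_concat' with rfl | ⟨p, u, rfl⟩
    · cases q with
      | nil => simp at hne
      | cons v t => simp [hxg.symm, add_comm]
    · cases q with
      | nil => simp [hxg.symm, add_comm]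
      | cons v t => cases p <;> simp [List.getLast?_cons]

theorem IsSegment.right_eq_zero {M : ℕ → ℕ → ℤ} {V O : Finset ℕ} {α β : ℕ → ℤ} {s : List ℕ} {d : ℕ}
    (hM : ∀ a b, M a b = M b a) (h : IsSegment M O α β s) (hV : V = O ∪ s.toFinset)
    (hac : Acyclic V M) (hd : d ∈ O) (hαd : α d = 1) (hβu : IsUnitOn O β)
    (hdeg : SmallDegree V M d) : β d = 0 := by
  have hsV : ∀ x ∈ s, x ∈ V := fun x hx => by simp [hV, hx]
  have hsd : ∀ x ∈ s, x ≠ d := by rintro x hx rfl; exact h.disj x hx hd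
  by_contra hβ
  have hβd : β d = 1 := by simpa using hβu d hd hβ d hd
  have hadd := fun x hx => h.attach x hx d hd
  rw [hαd, hβd] at hadd
  have hsing : ∀ x, s ≠ [x] := by
    rintro x rfl
    have := hadd x (by simp)
    rw [hM] at this
    rcases hdeg.1 x (hsV x (by simp)) (hsd x (by simp)) with h0 | h0 <;> simp [h0] at this
  have hnn : ∀ v ∈ insert d s.toFinset, ∀ u ∈ insert d s.toFinset, v ≠ u → 0 ≤ M v u := by
    have h1 : ∀ x ∈ s, 0 ≤ M x d := fun x hx => by
      rw [hadd x hx]; split_ifs <;> simp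
    intro v hv u hu hvu
    rw [Finset.mem_insert, List.mem_toFinset] at hv hu
    rcases hv with rfl | hv <;> rcases hu with rfl | hu
    · exact absurd rfl hvu
    · rw [hM]; exact h1 u hu
    · exact h1 v hv
    · rw [h.path.2 v hv u hu hvu]; exact link_nonneg _ _ _
  obtain ⟨v, hv, hsum⟩ := hac (insert d s.toFinset)
    (Finset.insert_subset (by simp [hV, hd]) (by rw [hV]; exact Finset.subset_union_right))
    (Finset.insert_nonempty _ _)
  suffices ∃ a ∈ insert d s.toFinset, ∃ b ∈ insert d s.toFinset,
      a ≠ v ∧ b ≠ v ∧ a ≠ b ∧ M v a = 1 ∧ M v b = 1 by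
    obtain ⟨a, ha, b, hb, hav, hbv, hab, h1, h2⟩ := this
    have hsub : ({a, b} : Finset ℕ) ⊆ (insert d s.toFinset).erase v := by
      intro x hx
      rw [Finset.mem_insert, Finset.mem_singleton] at hx
      rcases hx with rfl | rfl
      · exact Finset.mem_erase.2 ⟨hav, ha⟩
      · exact Finset.mem_erase.2 ⟨hbv, hb⟩
    have := Finset.sum_le_sum_of_subset_of_nonneg hsub (f := M v) fun u hu _ =>
      hnn v hv u (Finset.mem_of_mem_erase hu) (Finset.ne_of_mem_erase hu).symm
    rw [Finset.sum_pair hab, h1, h2] at this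
    linarith
  rw [Finset.mem_insert, List.mem_toFinset] at hv
  have hnd := h.path.1
  rcases hv with rfl | hv
  · cases s with
    | nil => exact absurd rfl h.ne
    | cons x t =>
      rcases t.eq_nil_or_concat' with rfl | ⟨t, y, rfl⟩
      · exact absurd rfl (hsing x)
      · have hxy : x ≠ y := by rintro rfl; simp at hnd
        refine ⟨x, by simp, y, by simp, hsd x (by simp), hsd y (by simp), hxy, ?_, ?_⟩
        · rw [hM, hadd x (by simp)]; simp [List.getLast?_cons, hxy.symm]
        · rw [hM, hadd y (by simp)]; simp [List.getLast?_cons, hxy]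
  · obtain ⟨p, q, rfl⟩ := List.append_of_mem hv
    have hvd := hsd v hv
    have hsplit := h.attach_split hd
    rw [hαd, hβd] at hsplit
    have hlink := fun y hy => h.path.link_left (y := y) hy
    rcases p.eq_nil_or_concat' with rfl | ⟨p, u, rfl⟩
    · cases q with
      | nil => exact absurd rfl (hsing v)
      | cons w t =>
        have hw : w ≠ v := by rintro rfl; simp at hnd
        exact ⟨d, by simp, w, by simp, hvd.symm, hw, (hsd w (by simp)).symm,
          by simp [hsplit], by rw [hlink w (by simp) hw]; simp⟩
    · have hu : u ≠ v := by rintro rfl; simp [List.nodup_append] at hnd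
      cases q with
      | nil =>
        exact ⟨d, by simp, u, by simp, hvd.symm, hu, (hsd u (by simp)).symm,
          by simp [hsplit], by rw [hlink u (by simp) hu]; simp⟩
      | cons w t =>
        have hw : w ≠ v := by rintro rfl; simp [List.nodup_append] at hnd
        have huw : u ≠ w := by rintro rfl; simp [List.nodup_append] at hnd
        exact ⟨u, by simp, w, by simp, hu, hw, huw,
          by rw [hlink u (by simp) hu]; simp [huw.symm],
          by rw [hlink w (by simp) hw]; simp [huw]⟩
theorem IsSegment.row_eq {M : ℕ → ℕ → ℤ} {O : Finset ℕ} {α β : ℕ → ℤ} {s : List ℕ} {d : ℕ}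
    (hM : ∀ a b, M a b = M b a) (h : IsSegment M O α β s) (hd : d ∈ O) (hα : α d = 1)
    (hβ : β d = 0) {x : ℕ} (hx : x ∈ s) : M d x = if s.head? = some x then 1 else 0 := by
  rw [hM, h.attach x hx d hd, hα, hβ]; simp

theorem IsSegment.cons {M : ℕ → ℕ → ℤ} {O : Finset ℕ} {α β : ℕ → ℤ} {s : List ℕ} {d : ℕ}
    (hM : ∀ a b, M a b = M b a) (h : IsSegment M O α β s) (hd : d ∈ O)
    (hα : ∀ o ∈ O, α o = if o = d then 1 else 0) (hβ : β d = 0) :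
    IsSegment M (O.erase d) (M d) β (d :: s) := by
  have hsd : ∀ x ∈ s, x ≠ d := by rintro x hx rfl; exact h.disj x hx hd
  have hrow : ∀ x ∈ s, M d x = if s.head? = some x then 1 else 0 := fun x hx =>
    h.row_eq hM hd (by simp [hα d hd]) hβ hx
  exact
  { path := by
      have hds : d ∉ s := fun hds => hsd d hds rfl
      have hnd : (d :: s).Nodup := List.nodup_cons.2 ⟨hds, h.path.1⟩
      have hcons : ∀ y ∈ s, M d y = link (d :: s) d y := fun y hy => by
        rw [hrow y hy]
        simpa using (link_split (p := []) (q := s) hnd y).symm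
      refine ⟨hnd, fun x hx y hy hxy => ?_⟩
      rw [List.mem_cons] at hx hy
      rcases hx with rfl | hx <;> rcases hy with rfl | hy
      · exact absurd rfl hxy
      · exact hcons y hy
      · rw [hM, link_comm]; exact hcons x hx
      · rw [h.path.2 x hx y hy hxy, link_cons_of_ne (hsd x hx) (hsd y hy)]
    ne := by simp
    disj := by
      intro x hx hx'
      rw [List.mem_cons] at hx
      rw [Finset.mem_erase] at hx'
      rcases hx with rfl | hx
      · exact hx'.1 rfl
      · exact h.disj x hx hx'.2
    attach := by
      intro x hx o ho
      rw [Finset.mem_erase] at ho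
      have hlast : (d :: s).getLast? = s.getLast? := by
        cases s with
        | nil => exact absurd rfl h.ne
        | cons a t => simp
      rw [hlast]
      rw [List.mem_cons] at hx
      rcases hx with rfl | hx
      · have : s.getLast? ≠ some x := fun h' => hsd x (List.mem_of_getLast? h') rfl
        simp [this]
      · rw [h.attach x hx o ho.2, hα o ho.2]
        simp [ho.1, (hsd x hx).symm] }

theorem IsSegment.isUnitOn_row {M : ℕ → ℕ → ℤ} {V O : Finset ℕ} {α β : ℕ → ℤ} {s : List ℕ} {d : ℕ}
    (hM : ∀ a b, M a b = M b a) (h : IsSegment M O α β s) (hV : V = O ∪ s.toFinset) (hd : d ∈ O)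
    (hα : α d = 1) (hβ : β d = 0) (hdeg : SmallDegree V M d) : IsUnitOn (O.erase d) (M d) := by
  have hsV : ∀ x ∈ s, x ∈ V := fun x hx => by simp [hV, hx]
  have hsd : ∀ x ∈ s, x ≠ d := by rintro x hx rfl; exact h.disj x hx hd
  obtain ⟨a, ha⟩ : ∃ a, s.head? = some a := by
    cases s with
    | nil => exact absurd rfl h.ne
    | cons a t => exact ⟨a, rfl⟩
  have has : a ∈ s := List.mem_of_head? ha
  have hda : M d a = 1 := by rw [h.row_eq hM hd hα hβ has, if_pos ha]
  have hOV : ∀ o ∈ O.erase d, o ∈ V ∧ o ≠ d ∧ o ≠ a := fun o ho => by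
    rw [Finset.mem_erase] at ho
    refine ⟨by simp [hV, ho.2], ho.1, ?_⟩
    rintro rfl; exact h.disj o has ho.2
  intro o ho hne o' ho'
  obtain ⟨h1, h2, h3⟩ := hOV o ho
  obtain ⟨h1', h2', h3'⟩ := hOV o' ho'
  have ho1 := (hdeg.1 o h1 h2).resolve_left hne
  split_ifs with hoo
  · rw [hoo, ho1]
  · refine (hdeg.1 o' h1' h2').resolve_right fun ho1' => ?_
    rcases hdeg.2 a (hsV a has) o h1 o' h1' (hsd a has) h2 h2' hda ho1 ho1' with h | h | h
    · exact h3 h.symm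
    · exact h3' h.symm
    · exact hoo h.symm

/-! ### Absorption of a graph into a segment -/

/-- A graph consisting of vertices `O` with matrix `M` and of a linear chain with weights `L`,
attached to `O` through `α` and `β`, can be reduced to a linear chain with sequence of weights
equivalent to `X` up to reversal, by enlarging the chain at its ends and by blowing down vertices of
`O` not attached to it. -/
inductive ChainAbsorbs (X : List ℤ) :
    Finset ℕ → (ℕ → ℕ → ℤ) → (ℕ → ℤ) → (ℕ → ℤ) → List ℤ → Prop
  | done {M : ℕ → ℕ → ℤ} {α β : ℕ → ℤ} {L : List ℤ} (hL : SeqEquivRev L X) :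
      ChainAbsorbs X ∅ M α β L
  | left {O : Finset ℕ} {M : ℕ → ℕ → ℤ} {α β : ℕ → ℤ} {L : List ℤ} (d : ℕ) (hd : d ∈ O)
      (hα : ∀ o ∈ O, α o = if o = d then 1 else 0) (hβ : β d = 0)
      (h : ChainAbsorbs X (O.erase d) M (M d) β (M d d :: L)) : ChainAbsorbs X O M α β L
  | right {O : Finset ℕ} {M : ℕ → ℕ → ℤ} {α β : ℕ → ℤ} {L : List ℤ} (d : ℕ) (hd : d ∈ O)
      (hβ : ∀ o ∈ O, β o = if o = d then 1 else 0) (hα : α d = 0)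
      (h : ChainAbsorbs X (O.erase d) M α (M d) (L ++ [M d d])) : ChainAbsorbs X O M α β L
  | contract {O : Finset ℕ} {M : ℕ → ℕ → ℤ} {α β : ℕ → ℤ} {L : List ℤ} (e : ℕ)
      (he : Contractible O M e) (hα : α e = 0) (hβ : β e = 0)
      (h : ChainAbsorbs X (O.erase e) (contr M e) α β L) : ChainAbsorbs X O M α β L

theorem ChainAbsorbs.reverse {X : List ℤ} {O : Finset ℕ} {M : ℕ → ℕ → ℤ} {α β : ℕ → ℤ} {L : List ℤ}
    (h : ChainAbsorbs X O M α β L) : ChainAbsorbs X O M β α L.reverse := by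
  induction h with
  | done hL => exact .done hL.reverse_left
  | left d hd hα hβ _ ih => exact .right d hd hα hβ (by simpa using ih)
  | right d hd hβ hα _ ih => exact .left d hd hβ hα (by simpa using ih)
  | contract e he hα hβ _ ih => exact .contract e he hβ hα ih

theorem SegEquiv.concat {k j : ℤ} {L L' : List ℤ} (h : SegEquiv k j L L') (a : ℤ) :
    SegEquiv k 0 (L ++ [a]) (L' ++ [a + j]) := by
  simpa using (h.reverse.cons a).reverse

theorem ChainAbsorbs.congr {X : List ℤ} {O : Finset ℕ} {M : ℕ → ℕ → ℤ} {α β : ℕ → ℤ} {L : List ℤ}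
    (h : ChainAbsorbs X O M α β L) {k j : ℤ} {M' : ℕ → ℕ → ℤ} {α' β' : ℕ → ℤ} {L' : List ℤ}
    (hM : ∀ a ∈ O, ∀ b ∈ O, M' a b = M a b + k * (α a * α b) + j * (β a * β b))
    (hα' : ∀ a ∈ O, α' a = α a) (hβ' : ∀ a ∈ O, β' a = β a) (hL : SegEquiv k j L L') :
    ChainAbsorbs X O M' α' β' L' := by
  induction h generalizing k j M' α' β' L' with
  | done h => exact .done (h.of_seqEquiv_left hL.symm.seqEquiv)
  | @left O M α β L d hd hα hβ _ ih =>
    have hα0 : ∀ a ∈ O.erase d, α a = 0 := fun a ha => by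
      rw [Finset.mem_erase] at ha; simp [hα a ha.2, ha.1]
    have hαd : α d = 1 := by simp [hα d hd]
    refine .left d hd (fun o ho => by rw [hα' o ho, hα o ho]) (by rw [hβ' d hd, hβ])
      (ih (k := 0) (j := j)
      (fun a ha b hb => ?_) (fun a ha => ?_) (fun a ha => hβ' a (Finset.mem_of_mem_erase ha)) ?_)
    · rw [hM a (Finset.mem_of_mem_erase ha) b (Finset.mem_of_mem_erase hb), hα0 a ha]; ring
    · rw [hM d hd a (Finset.mem_of_mem_erase ha), hα0 a ha, hβ]; ring
    · have : M' d d = M d d + k := by rw [hM d hd d hd, hαd, hβ]; ring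
      rw [this]; exact hL.cons _
  | @right O M α β L d hd hβ hα _ ih =>
    have hβ0 : ∀ a ∈ O.erase d, β a = 0 := fun a ha => by
      rw [Finset.mem_erase] at ha; simp [hβ a ha.2, ha.1]
    have hβd : β d = 1 := by simp [hβ d hd]
    refine .right d hd (fun o ho => by rw [hβ' o ho, hβ o ho]) (by rw [hα' d hd, hα])
      (ih (k := k) (j := 0)
      (fun a ha b hb => ?_) (fun a ha => hα' a (Finset.mem_of_mem_erase ha)) (fun a ha => ?_) ?_)
    · rw [hM a (Finset.mem_of_mem_erase ha) b (Finset.mem_of_mem_erase hb), hβ0 a ha]; ring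
    · rw [hM d hd a (Finset.mem_of_mem_erase ha), hβ0 a ha, hα]; ring
    · have : M' d d = M d d + j := by rw [hM d hd d hd, hβd, hα]; ring
      rw [this]; exact hL.concat _
  | @contract O M α β L e he hα hβ _ ih =>
    have hrow : ∀ a ∈ O, M' e a = M e a := fun a ha => by
      rw [hM e he.1 a ha, hα, hβ]; ring
    refine .contract e ⟨he.1, by rw [hrow e he.1, he.2.1], ?_, ?_⟩ (by rw [hα' e he.1, hα])
      (by rw [hβ' e he.1, hβ]) (ih (k := k) (j := j) (fun a ha b hb => ?_)
        (fun a ha => hα' a (Finset.mem_of_mem_erase ha))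
        (fun a ha => hβ' a (Finset.mem_of_mem_erase ha)) hL)
    · intro a ha; rw [hrow a ha]; exact he.2.2.1 a ha
    · intro a ha b hb c hc; rw [hrow a ha, hrow b hb, hrow c hc]; exact he.2.2.2 a ha b hb c hc
    · have ha' := Finset.mem_of_mem_erase ha
      have hb' := Finset.mem_of_mem_erase hb
      simp only [contr]
      rw [hM a ha' b hb', hrow a ha', hrow b hb']; ring

/-- Blowing down a vertex of a segment does not affect absorption. -/
theorem ChainAbsorbs.of_contr {X : List ℤ} {O : Finset ℕ} {M : ℕ → ℕ → ℤ} {α β : ℕ → ℤ}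
    {p q : List ℕ} {g : ℕ} (h : IsSegment M O α β (p ++ g :: q)) (hg : M g g = -1)
    (hne : p ++ q ≠ []) (hab : ChainAbsorbs X O (contr M g) α β (weights (contr M g) (p ++ q))) :
    ChainAbsorbs X O M α β (weights M (p ++ g :: q)) := by
  refine hab.congr (fun a ha b hb => ?_) (fun _ _ => rfl) (fun _ _ => rfl)
    (h.path.weights_contr hg hne).symm
  simp only [contr]
  rw [h.attach_split ha, h.attach_split hb]
  by_cases hp : p = [] <;> by_cases hq : q = []
  · simp [hp, hq] at hne
  all_goals simp [hp, hq]

theorem union_toFinset_cons {O : Finset ℕ} {d : ℕ} (hd : d ∈ O) (s : List ℕ) :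
    O.erase d ∪ (d :: s).toFinset = O ∪ s.toFinset := by
  rw [List.toFinset_cons, Finset.union_insert, ← Finset.insert_union, Finset.insert_erase hd]

/-- If the segment of a graph absorbs the rest of it, then the graph can be blown down to a linear
chain. -/
theorem ChainAbsorbs.reduces {X : List ℤ} {O : Finset ℕ} {M : ℕ → ℕ → ℤ} {α β : ℕ → ℤ} {L : List ℤ}
    (h : ChainAbsorbs X O M α β L) {V : Finset ℕ} {s : List ℕ} (hM : ∀ a b, M a b = M b a)
    (hs : IsSegment M O α β s) (hV : V = O ∪ s.toFinset) (hL : L = weights M s) :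
    Reduces X V M := by
  induction h generalizing V s with
  | done h => exact .path s (by simpa using hV) hs.path (hL ▸ h)
  | left d hd hα hβ _ ih =>
    exact ih hM (hs.cons hM hd hα hβ) (by rw [hV, union_toFinset_cons hd]) (by simp [hL])
  | right d hd hβ hα _ ih =>
    refine ih hM (s := s ++ [d]) ?_ ?_ (by simp [hL])
    · simpa using (hs.reverse.cons hM hd hβ hα).reverse
    · rw [hV, ← union_toFinset_cons hd]; congr 1; ext; simp
  | @contract O M α β L e he hα hβ _ ih =>
    have hes : e ∉ s := fun h => hs.disj e h he.1
    have hrow : ∀ x ∈ s, M e x = 0 := fun x hx => by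
      rw [hM, hs.attach x hx e he.1, hα, hβ]; simp
    have hVmem : ∀ a ∈ V, a ∈ O ∨ M e a = 0 := fun a ha => by
      have ha' : a ∈ O ∨ a ∈ s := by simpa [hV] using ha
      exact ha'.imp_right (hrow a)
    refine .step e ⟨by simp [hV, he.1], he.2.1, fun a ha hae => ?_, ?_⟩
      (ih (contr_symm hM e) (hs.erase hM he.1 hα hβ) ?_ (by rw [hL, weights_contr hrow]))
    · exact (hVmem a ha).elim (fun h => he.2.2.1 a h hae) .inl
    · intro a ha b hb c hc h1 h2 h3 h4 h5 h6
      have hO : ∀ a ∈ V, M e a = 1 → a ∈ O := fun a ha h =>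
        (hVmem a ha).resolve_right (by rw [h]; exact one_ne_zero)
      exact he.2.2.2 a (hO a ha h4) b (hO b hb h5) c (hO c hc h6) h1 h2 h3 h4 h5 h6
    · rw [hV, Finset.erase_union_distrib, Finset.erase_eq_of_notMem (s := s.toFinset) (by simpa)]

theorem path_eq_of_head_eq {M : ℕ → ℕ → ℤ} {a : ℕ} {t t' : List ℕ} (h : IsPath M (a :: t))
    (h' : IsPath M (a :: t')) (hmem : ∀ x, x ∈ a :: t ↔ x ∈ a :: t') : t = t' := by
  induction t generalizing a t' with
  | nil =>
    cases t' with
    | nil => rfl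
    | cons c t' =>
      have h1 := (hmem c).2 (by simp)
      have h2 := h'.1
      simp at h1
      simp [h1] at h2
  | cons b t ih =>
    have hab : b ≠ a := by rintro rfl; have := h.1; simp at this
    have h1 := IsPath.link_left (p := []) h (y := b) (by simp) hab
    have h2 := IsPath.link_left (p := []) h' (y := b) ((hmem b).1 (by simp)) hab
    cases t' with
    | nil => simp [h2] at h1
    | cons c t' =>
      obtain rfl : c = b := by
        by_contra hcb
        simp [h2, hcb] at h1
      congr 1
      refine ih h.tail h'.tail fun x => ?_
      have ha := (List.nodup_cons.1 h.1).1
      have ha' := (List.nodup_cons.1 h'.1).1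
      have := hmem x
      constructor
      · intro hx
        have hxa : x ≠ a := by rintro rfl; exact ha hx
        exact List.mem_of_ne_of_mem hxa (this.1 (List.mem_cons_of_mem _ hx))
      · intro hx
        have hxa : x ≠ a := by rintro rfl; exact ha' hx
        exact List.mem_of_ne_of_mem hxa (this.2 (List.mem_cons_of_mem _ hx))

/-- A linear chain can be laid out in only one way, up to reversal. -/
theorem IsPath.eq_or_eq_reverse {M : ℕ → ℕ → ℤ} {s s' : List ℕ} (h : IsPath M s)
    (h' : IsPath M s') (hmem : ∀ x, x ∈ s ↔ x ∈ s') : s = s' ∨ s = s'.reverse := by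
  cases s with
  | nil =>
    left
    cases s' with
    | nil => rfl
    | cons a t => simpa using hmem a
  | cons a t =>
    obtain ⟨p, q, rfl⟩ := List.append_of_mem ((hmem a).1 (by simp))
    rcases p.eq_nil_or_concat' with rfl | ⟨p, u, rfl⟩
    · left
      rw [List.nil_append, path_eq_of_head_eq h h' hmem]
    cases q with
    | nil =>
      right
      have h1 := h'.reverse
      simp only [List.reverse_append, List.reverse_cons, List.reverse_nil, List.nil_append,
        List.cons_append] at h1 ⊢
      rw [path_eq_of_head_eq h h1 fun x => by rw [hmem]; simp; tauto]
    | cons w q =>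
      exfalso
      have hnd := h'.1
      have hu : u ≠ a := by rintro rfl; simp [List.nodup_append] at hnd
      have hw : w ≠ a := by rintro rfl; simp [List.nodup_append] at hnd
      have huw : u ≠ w := by rintro rfl; simp [List.nodup_append] at hnd
      have h1 := h'.link_left (y := u) (by simp) hu
      have h2 := h'.link_left (y := w) (by simp) hw
      rw [IsPath.link_left (p := []) h ((hmem u).2 (by simp)) hu] at h1
      rw [IsPath.link_left (p := []) h ((hmem w).2 (by simp)) hw] at h2
      simp [huw, huw.symm] at h1 h2
      rw [h1] at h2
      simp [huw] at h2

theorem exists_link_ne_zero (P : ℕ → Prop) {l : List ℕ} (h : ∃ x ∈ l, P x)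
    (h' : ∃ x ∈ l, ¬ P x) : ∃ x ∈ l, ∃ y ∈ l, P x ∧ ¬ P y ∧ link l x y ≠ 0 := by
  induction l with
  | nil => simp at h
  | cons a l ih =>
    cases l with
    | nil => simp at h h'; exact absurd h h'
    | cons b l =>
      have hpos := link_nonneg (b :: l)
      by_cases hab : (P a ↔ P b)
      · obtain ⟨x, hx, y, hy, h1, h2, h3⟩ := ih
          (by
            obtain ⟨x, hx, hPx⟩ := h
            rcases List.mem_cons.1 hx with rfl | hx
            · exact ⟨b, by simp, hab.1 hPx⟩
            · exact ⟨x, hx, hPx⟩)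
          (by
            obtain ⟨x, hx, hPx⟩ := h'
            rcases List.mem_cons.1 hx with rfl | hx
            · exact ⟨b, by simp, fun hb => hPx (hab.2 hb)⟩
            · exact ⟨x, hx, hPx⟩)
        refine ⟨x, List.mem_cons_of_mem _ hx, y, List.mem_cons_of_mem _ hy, h1, h2, ?_⟩
        have := hpos x y
        rw [link_cons_cons]; split_ifs <;> omega
      · by_cases ha : P a
        · have hb : ¬ P b := fun hb => hab ⟨fun _ => hb, fun _ => ha⟩
          refine ⟨a, by simp, b, by simp, ha, hb, ?_⟩
          have := hpos a b
          rw [link_cons_cons, if_pos (by tauto)]; omega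
        · have hb : P b := by tauto
          refine ⟨b, by simp, a, by simp, hb, ha, ?_⟩
          have := hpos b a
          rw [link_cons_cons, if_pos (by tauto)]; omega

/-- A segment of a linear chain absorbs the whole chain. -/
theorem IsPath.absorbs {X : List ℤ} {V : Finset ℕ} {M : ℕ → ℕ → ℤ} {l : List ℕ}
    (hM : ∀ a b, M a b = M b a) (hl : IsPath M l) (hVl : V = l.toFinset)
    (hX : SeqEquivRev (weights M l) X) {O : Finset ℕ} {α β : ℕ → ℤ} {s : List ℕ}
    (hs : IsSegment M O α β s) (hα : IsUnitOn O α) (hβ : IsUnitOn O β)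
    (hV : V = O ∪ s.toFinset) : ChainAbsorbs X O M α β (weights M s) := by
  have hac : Acyclic V M := hVl ▸ hl.acyclic
  induction hn : O.card generalizing O α β s with
  | zero =>
    obtain rfl := Finset.card_eq_zero.1 hn
    refine .done ?_
    rcases hl.eq_or_eq_reverse hs.path fun x => by
      have := congrArg (x ∈ ·) (hVl.symm.trans hV)
      simpa using this with rfl | rfl
    · exact hX
    · simpa using hX.reverse_left
  | succ n ih =>
    have key : ∀ {α β : ℕ → ℤ} {s : List ℕ}, IsSegment M O α β s → IsUnitOn O α → IsUnitOn O β →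
        V = O ∪ s.toFinset → ∀ d ∈ O, α d ≠ 0 → ChainAbsorbs X O M α β (weights M s) := by
      intro α β s hs hαu hβu hV d hd hα
      have hdeg : SmallDegree V M d := by
        have : d ∈ V := by simp [hV, hd]
        rw [hVl] at this ⊢
        exact hl.smallDegree (List.mem_toFinset.1 this)
      have hα' := hαu d hd hα
      have hαd : α d = 1 := by simp [hα' d hd]
      have hβ := hs.right_eq_zero hM hV hac hd hαd hβu hdeg
      exact .left d hd hα' hβ (ih (hs.cons hM hd hα' hβ)
        (hs.isUnitOn_row hM hV hd hαd hβ hdeg) (hβu.mono (Finset.erase_subset _ _))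
        (by rw [hV, union_toFinset_cons hd]) (by rw [Finset.card_erase_of_mem hd, hn]; rfl))
    have hmem : ∀ x, x ∈ l ↔ x ∈ O ∨ x ∈ s := fun x => by
      have := congrArg (x ∈ ·) (hVl.symm.trans hV)
      simpa using this
    obtain ⟨o, ho⟩ : O.Nonempty := Finset.card_pos.1 (by omega)
    obtain ⟨a, ha⟩ := List.exists_mem_of_ne_nil s hs.ne
    obtain ⟨x, hx, y, hy, hxs, hys, hxy⟩ := exists_link_ne_zero (· ∈ s) (l := l)
      ⟨a, (hmem a).2 (.inr ha), ha⟩ ⟨o, (hmem o).2 (.inl ho), fun h => hs.disj o h ho⟩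
    have hyO := ((hmem y).1 hy).resolve_right hys
    rw [← hl.2 x hx y hy (by rintro rfl; exact hys hxs), hs.attach x hxs y hyO] at hxy
    by_cases hαy : α y = 0
    · have hβy : β y ≠ 0 := by
        intro hβy; simp [hαy, hβy] at hxy
      simpa using (key hs.reverse hβ hα (by simpa using hV) y hyO hβy).reverse
    · exact key hs hα hβ hV y hyO hαy

/-! ### Blowing down is confluent -/

theorem toFinset_append_eq_erase {p q : List ℕ} {g : ℕ} (h : (p ++ g :: q).Nodup) :
    (p ++ q).toFinset = (p ++ g :: q).toFinset.erase g := by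
  ext x
  by_cases hxg : x = g
  · subst hxg; simp [List.nodup_append] at h ⊢; grind
  · simp [hxg]

/-- If a graph can be blown down to a linear chain, then any of its segments which is not negative
definite absorbs the whole graph. -/
theorem Reduces.absorbs {X : List ℤ} {V : Finset ℕ} {M : ℕ → ℕ → ℤ} (h : Reduces X V M)
    (hM : ∀ a b, M a b = M b a) {O : Finset ℕ} {α β : ℕ → ℤ} {s : List ℕ}
    (hs : IsSegment M O α β s) (hα : IsUnitOn O α) (hβ : IsUnitOn O β) (hV : V = O ∪ s.toFinset)
    (hnd : NotNegDef M s.toFinset) : ChainAbsorbs X O M α β (weights M s) := by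
  induction h generalizing O α β s with
  | path l hVl hl hX => exact hl.absorbs hM hVl hX hs hα hβ hV
  | @step V M g hg h ih =>
    have hac : Acyclic V M := (Reduces.step g hg h).acyclic hM
    by_cases hgs : g ∈ s
    · obtain ⟨p, q, rfl⟩ := List.append_of_mem hgs
      have hgO := hs.disj g hgs
      have hset := toFinset_append_eq_erase hs.path.1
      have hne : p ++ q ≠ [] := by
        intro h0
        obtain ⟨rfl, rfl⟩ := List.append_eq_nil_iff.1 h0
        exact not_notNegDef_singleton hg.2.1 (by simpa using hnd)
      refine .of_contr hs hg.2.1 hne (ih (contr_symm hM g) (hs.contr hne) hα hβ ?_ ?_)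
      · rw [hV, hset, Finset.erase_union_distrib, Finset.erase_eq_of_notMem hgO]
      · rw [hset]; exact hnd.contr hM (by simp) hg.2.1
    · have hgO : g ∈ O := by
        have := hg.1
        rw [hV] at this
        simpa [hgs] using this
      have key : ∀ {α β : ℕ → ℤ} {s : List ℕ}, IsSegment M O α β s → IsUnitOn O α → IsUnitOn O β →
          V = O ∪ s.toFinset → NotNegDef M s.toFinset → g ∉ s → α g ≠ 0 →
          ChainAbsorbs X O M α β (weights M s) := by
        intro α β s hs hαu hβu hV hnd hgs hα
        have hα' := hαu g hgO hα
        have hαg : α g = 1 := by simp [hα' g hgO]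
        have hβ := hs.right_eq_zero hM hV hac hgO hαg hβu hg.2.2
        have hcons := hs.cons hM hgO hα' hβ
        have hset : s.toFinset = (g :: s).toFinset.erase g := by
          rw [List.toFinset_cons, Finset.erase_insert (by simpa)]
        refine .left g hgO hα' hβ (.of_contr (p := []) hcons hg.2.1 hs.ne
          (ih (contr_symm hM g) (IsSegment.contr (p := []) hcons hs.ne)
            (hs.isUnitOn_row hM hV hgO hαg hβ hg.2.2) (hβu.mono (Finset.erase_subset _ _)) ?_ ?_))
        · rw [hV, List.nil_append, Finset.erase_union_distrib,
            Finset.erase_eq_of_notMem (s := s.toFinset) (by simpa)]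
        · rw [List.nil_append, hset]
          exact (hnd.mono (by simp)).contr hM (by simp) hg.2.1
      by_cases hαg : α g = 0
      · by_cases hβg : β g = 0
        · have h0 : ∀ x ∈ s, M g x = 0 := fun x hx => by
            rw [hM, hs.attach x hx g hgO, hαg, hβg]; simp
          refine .contract g ⟨hgO, hg.2.1, hg.2.2.mono (by rw [hV]; exact Finset.subset_union_left)⟩
            hαg hβg ?_
          rw [← weights_contr h0]
          refine ih (contr_symm hM g) (hs.erase hM hgO hαg hβg) (hα.mono (Finset.erase_subset _ _))
            (hβ.mono (Finset.erase_subset _ _)) ?_ ?_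
          · rw [hV, Finset.erase_union_distrib,
              Finset.erase_eq_of_notMem (s := s.toFinset) (by simpa)]
          · have hset : s.toFinset = (g :: s).toFinset.erase g := by
              rw [List.toFinset_cons, Finset.erase_insert (by simpa)]
            rw [hset]
            exact (hnd.mono (by simp)).contr hM (by simp) hg.2.1
        · simpa using (key hs.reverse hβ hα (by simpa using hV) (by simpa using hnd)
            (by simpa using hgs) hβg).reverse
      · exact key hs hα hβ hV hnd hgs hαg

theorem IsSegment.singleton {M : ℕ → ℕ → ℤ} {O : Finset ℕ} {α β : ℕ → ℤ} {f : ℕ} (hf : f ∉ O)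
    (h : ∀ o ∈ O, M f o = α o + β o) : IsSegment M O α β [f] where
  path := ⟨by simp, by simp⟩
  ne := by simp
  disj := by simpa using hf
  attach := by simpa using h

/-- Blowing down any vertex of a graph which can be blown down to a linear chain leads to a graph
which can be blown down to an equivalent linear chain. -/
theorem Reduces.contr {X : List ℤ} {V : Finset ℕ} {M : ℕ → ℕ → ℤ} (h : Reduces X V M)
    (hM : ∀ a b, M a b = M b a) {e : ℕ} (he : Contractible V M e) :
    Reduces X (V.erase e) (contr M e) := by
  induction h generalizing e with
  | path s hV hs hX =>
    subst hV
    obtain ⟨p, q, rfl⟩ := List.append_of_mem (List.mem_toFinset.1 he.1)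
    exact .path (p ++ q) (toFinset_append_eq_erase hs.1).symm hs.contr
      (hX.of_seqEquiv_left (hs.seqEquiv_contr he.2.1).symm)
  | @step V M f hf h ih =>
    by_cases hfe : e = f
    · exact hfe ▸ h
    by_cases h0 : M f e = 0
    · have h0' : M e f = 0 := hM f e ▸ h0
      have h1 := ih (contr_symm hM f) (he.erase_contr hfe h0)
      rw [Finset.erase_right_comm, contr_comm hM h0] at h1
      exact .step f (hf.erase_contr (Ne.symm hfe) h0') h1
    · have h1 : M f e = 1 := (hf.2.2.1 e he.1 hfe).resolve_left h0
      have h1' : M e f = 1 := hM f e ▸ h1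
      have hunit : ∀ {e f : ℕ}, Contractible V M e → f ∈ V → M e f = 1 → f ≠ e →
          IsUnitOn ((V.erase f).erase e) (M e) := by
        intro e f he hf hef hfe o ho hoe o' ho'
        simp only [Finset.mem_erase] at ho ho'
        have ho1 := (he.2.2.1 o ho.2.2 ho.1).resolve_left hoe
        split_ifs with h
        · rw [h, ho1]
        · refine (he.2.2.1 o' ho'.2.2 ho'.1).resolve_right fun ho'1 => ?_
          have := he.2.2.2 f hf o ho.2.2 o' ho'.2.2 hfe ho.1 ho'.1 hef ho1 ho'1
          grind
      set O := (V.erase f).erase e with hO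
      have hO' : O = (V.erase e).erase f := Finset.erase_right_comm
      have hα : IsUnitOn O (M e) := hunit he hf.1 h1' (Ne.symm hfe)
      have hβ : IsUnitOn O (M f) := hO' ▸ hunit hf he.1 h1 hfe
      have hfO : f ∉ O := by simp [hO]
      have heO : e ∉ O := by simp [hO]
      have habs := h.absorbs (contr_symm hM f) (O := O) (α := M e) (β := M f) (s := [e])
        (.singleton heO fun o _ => by simp [_root_.contr, h1]) hα hβ
        (by
          rw [hO, List.toFinset_cons, Finset.union_insert]
          simp [hfe, he.1])
        ⟨fun _ => 1, ⟨e, by simp⟩, by simp [_root_.contr, h1, he.2.1]⟩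
      have hseg : IsSegment (_root_.contr M e) O (M e) (M f) [f] :=
        .singleton hfO fun o _ => by simp [_root_.contr, h1', add_comm]
      have hw : weights (_root_.contr M f) [e] = [0] := by
        simp [weights, _root_.contr, h1, he.2.1]
      have hw' : weights (_root_.contr M e) [f] = [0] := by
        simp [weights, _root_.contr, h1', hf.2.1]
      rw [hw] at habs
      have hr : SegEquiv 0 (-1) [0] [-1, -1] := by simpa using SegEquiv.right 0 []
      have hl : SegEquiv (-1) 0 [0] [-1, -1] := by simpa using SegEquiv.left 0 []
      have h2 := habs.congr (M' := M) (fun a _ b _ => by simp only [_root_.contr]; ring)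
        (fun _ _ => rfl) (fun _ _ => rfl) hr
      have h3 := h2.congr (M' := _root_.contr M e) (k := 1) (j := 0)
        (fun a _ b _ => by simp only [_root_.contr]; ring)
        (fun _ _ => rfl) (fun _ _ => rfl) (by simpa using hl.symm)
      refine h3.reduces (contr_symm hM e) hseg ?_ hw'.symm
      rw [hO', List.toFinset_cons, Finset.union_insert]
      simp [Ne.symm hfe, hf.1]

theorem Reduces.seqEquivRev {X : List ℤ} {V : Finset ℕ} {M : ℕ → ℕ → ℤ} (h : Reduces X V M)
    (hM : ∀ a b, M a b = M b a) {s : List ℕ} (hs : IsPath M s) (hV : V = s.toFinset) :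
    SeqEquivRev (weights M s) X := by
  induction h generalizing s with
  | path l hVl hl hX =>
    rcases hl.eq_or_eq_reverse hs fun x => by
      have := congrArg (x ∈ ·) (hVl.symm.trans hV)
      simpa using this with rfl | rfl
    · exact hX
    · simpa using hX.reverse_left
  | step e he _ ih =>
    subst hV
    obtain ⟨p, q, rfl⟩ := List.append_of_mem (List.mem_toFinset.1 he.1)
    exact (ih (contr_symm hM e) hs.contr (toFinset_append_eq_erase hs.1).symm).of_seqEquiv_left
      (hs.seqEquiv_contr he.2.1)

theorem Reduces.image {X : List ℤ} {V : Finset ℕ} {M M' : ℕ → ℕ → ℤ} (h : Reduces X V M)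
    {f : ℕ → ℕ} (hf : Set.InjOn f V) (hM : ∀ a ∈ V, ∀ b ∈ V, M' (f a) (f b) = M a b) :
    Reduces X (V.image f) M' := by
  induction h generalizing M' with
  | @path V M s hV hs hX =>
    subst hV
    simp only [List.mem_toFinset] at hM
    have hf' : Set.InjOn f {a | a ∈ s} := by simpa using hf
    refine .path (s.map f) (by ext; simp) ⟨hs.1.map_on fun x hx y hy h => hf' hx hy h, ?_⟩ ?_
    · simp only [List.mem_map, forall_exists_index, and_imp]
      rintro _ x hx rfl _ y hy rfl hxy
      rw [hM x hx y hy, link_map hf' hx hy, hs.2 x hx y hy fun h => hxy (h ▸ rfl)]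
    · have : weights M' (s.map f) = weights M s := by
        simp only [weights, List.map_map]
        exact List.map_congr_left fun x hx => hM x hx x hx
      rwa [this]
  | @step V M e he _ ih =>
    have himg : (V.image f).erase (f e) = (V.erase e).image f := by
      ext y
      simp only [Finset.mem_erase, Finset.mem_image]
      constructor
      · rintro ⟨hy, x, hx, rfl⟩
        exact ⟨x, ⟨fun h => hy (h ▸ rfl), hx⟩, rfl⟩
      · rintro ⟨x, ⟨hxe, hx⟩, rfl⟩
        exact ⟨fun h => hxe (hf hx he.1 h), x, hx, rfl⟩
    refine .step (f e) ⟨Finset.mem_image_of_mem f he.1, by rw [hM e he.1 e he.1, he.2.1], ?_, ?_⟩ ?_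
    · simp only [Finset.forall_mem_image]
      intro a ha hae
      rw [hM e he.1 a ha]
      exact he.2.2.1 a ha fun h => hae (h ▸ rfl)
    · simp only [Finset.forall_mem_image]
      intro a ha b hb c hc hae hbe hce
      rw [hM e he.1 a ha, hM e he.1 b hb, hM e he.1 c hc]
      intro h1 h2 h3
      have := he.2.2.2 a ha b hb c hc (fun h => hae (h ▸ rfl)) (fun h => hbe (h ▸ rfl))
        (fun h => hce (h ▸ rfl)) h1 h2 h3
      exact this.imp (congrArg f) (Or.imp (congrArg f) (congrArg f))
    · rw [himg]
      refine ih (hf.mono (by simp)) fun a ha b hb => ?_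
      rw [Finset.mem_erase] at ha hb
      simp only [_root_.contr, hM _ ha.2 _ hb.2, hM e he.1 _ ha.2, hM e he.1 _ hb.2]

theorem Reduces.congr {X : List ℤ} {V : Finset ℕ} {M M' : ℕ → ℕ → ℤ} (h : Reduces X V M)
    (hM : ∀ a ∈ V, ∀ b ∈ V, M' a b = M a b) : Reduces X V M' := by
  simpa using h.image (f := id) (Set.injOn_id _) hM

/-! ### Weighted graphs -/

/-- The intersection matrix of a weighted graph. -/
def WGraph.matrix (G : WGraph) (a b : ℕ) : ℤ :=
  if a = b then G.wt a else if G.adj a b = true then 1 else 0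

theorem WGraph.matrix_symm (G : WGraph) (a b : ℕ) : G.matrix a b = G.matrix b a := by
  unfold WGraph.matrix
  by_cases h : a = b
  · rw [h]
  · rw [if_neg h, if_neg (Ne.symm h), G.symm]

@[simp] theorem WGraph.matrix_self (G : WGraph) (a : ℕ) : G.matrix a a = G.wt a := if_pos rfl

theorem WGraph.matrix_of_ne (G : WGraph) {a b : ℕ} (h : a ≠ b) :
    G.matrix a b = if G.adj a b = true then 1 else 0 := if_neg h

theorem WGraph.Iso.symm {G G' : WGraph} (h : G.Iso G') : G'.Iso G := by
  obtain ⟨f, hf, hadj, hwt⟩ := h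
  have hinv := hf.invOn_invFunOn
  have hbij := Set.BijOn.symm hinv.symm hf
  refine ⟨Function.invFunOn f G.verts, hbij, fun u hu v hv => ?_, fun v hv => ?_⟩
  · rw [← hadj _ (hbij.mapsTo hu) _ (hbij.mapsTo hv), hinv.2 hu, hinv.2 hv]
  · rw [← hwt _ (hbij.mapsTo hv), hinv.2 hv]

theorem WGraph.Iso.reduces {G G' : WGraph} (h : G.Iso G') {X : List ℤ}
    (hG : Reduces X G.verts G.matrix) : Reduces X G'.verts G'.matrix := by
  obtain ⟨f, hf, hadj, hwt⟩ := h
  have : G'.verts = G.verts.image f := by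
    rw [← Finset.coe_inj, Finset.coe_image, hf.image_eq]
  rw [this]
  refine hG.image hf.injOn fun a ha b hb => ?_
  by_cases hab : a = b
  · subst hab; simp [hwt a ha]
  · rw [G.matrix_of_ne hab, G'.matrix_of_ne fun h => hab (hf.injOn ha hb h), hadj a ha b hb]

theorem WBlowup.exists_contractible {G G' : WGraph} (h : WBlowup G G') :
    ∃ e, Contractible G'.verts G'.matrix e ∧ G.verts = G'.verts.erase e ∧
      ∀ a ∈ G.verts, ∀ b ∈ G.verts, contr G'.matrix e a b = G.matrix a b := by
  have hmem : ∀ {G : WGraph} {e a}, e ∉ G.verts → G.adj e a = false := fun {G e a} he => by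
    by_contra h
    exact he (G.adj_mem e a (by simpa using h)).1
  have h01 : ∀ a e, a ≠ e → G'.matrix e a = 0 ∨ G'.matrix e a = 1 := fun a e h => by
    rw [G'.matrix_of_ne h.symm]; split_ifs <;> simp
  rcases h with ⟨v, e, hv, he, hV, hadj, hwe, hwv, hwt⟩ |
    ⟨v₁, v₂, e, h12, he, hV, hadj, hwe, hw1, hw2, hwt⟩ | ⟨e, he, hV, hadj, hwe, hwt⟩
  · have hrow : ∀ a, a ≠ e → G'.matrix e a = if a = v then 1 else 0 := fun a ha => by
      rw [G'.matrix_of_ne ha.symm]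
      grind [hadj e a, hmem he (a := a)]
    refine ⟨e, ⟨by simp [hV], by simp [hwe], fun a _ => h01 a e, ?_⟩, by simp [hV, he], ?_⟩
    · intro a _ b _ c _ ha hb hc
      rw [hrow a ha, hrow b hb]
      grind
    · intro a ha b hb
      have hae : a ≠ e := by rintro rfl; exact he ha
      have hbe : b ≠ e := by rintro rfl; exact he hb
      rw [contr, hrow a hae, hrow b hbe]
      by_cases hab : a = b
      · subst hab
        simp only [WGraph.matrix_self]
        by_cases hav : a = v
        · subst hav; simp [hwv]
        · simp [hav, hwt a ha hav]
      · rw [G.matrix_of_ne hab, G'.matrix_of_ne hab]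
        grind [hadj a b]
  · have hne : v₁ ≠ v₂ := by rintro rfl; simp [G.irrefl] at h12
    have hrow : ∀ a, a ≠ e → G'.matrix e a = if a = v₁ ∨ a = v₂ then 1 else 0 := fun a ha => by
      rw [G'.matrix_of_ne ha.symm]
      grind [hadj e a, hmem he (a := a)]
    refine ⟨e, ⟨by simp [hV], by simp [hwe], fun a _ => h01 a e, ?_⟩, by simp [hV, he], ?_⟩
    · intro a _ b _ c _ ha hb hc
      rw [hrow a ha, hrow b hb, hrow c hc]
      grind
    · intro a ha b hb
      have hae : a ≠ e := by rintro rfl; exact he ha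
      have hbe : b ≠ e := by rintro rfl; exact he hb
      have h21 : G.adj v₂ v₁ = true := by rw [G.symm, h12]
      rw [contr, hrow a hae, hrow b hbe]
      by_cases hab : a = b
      · subst hab
        simp only [WGraph.matrix_self]
        by_cases h1 : a = v₁
        · subst h1; simp [hw1]
        by_cases h2 : a = v₂
        · subst h2; simp [hw2]
        simp [h1, h2, hwt a ha h1 h2]
      · rw [G.matrix_of_ne hab, G'.matrix_of_ne hab]
        grind [hadj a b]
  · have hrow : ∀ a, a ≠ e → G'.matrix e a = 0 := fun a ha => by
      simp [G'.matrix_of_ne ha.symm, hadj, hmem he]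
    refine ⟨e, ⟨by simp [hV], by simp [hwe], fun a _ => h01 a e, ?_⟩, by simp [hV, he], ?_⟩
    · intro a _ b _ c _ ha hb hc
      rw [hrow a ha]
      simp
    · intro a ha b hb
      have hae : a ≠ e := by rintro rfl; exact he ha
      rw [contr, hrow a hae]
      by_cases hab : a = b
      · subst hab; simp [hwt a ha]
      · simp [G.matrix_of_ne hab, G'.matrix_of_ne hab, hadj]

theorem WBlowup.reduces_iff {G G' : WGraph} (h : WBlowup G G') {X : List ℤ} :
    Reduces X G.verts G.matrix ↔ Reduces X G'.verts G'.matrix := by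
  obtain ⟨e, he, hV, hM⟩ := h.exists_contractible
  constructor
  · intro hG
    exact .step e he (hV ▸ hG.congr hM)
  · intro hG
    rw [hV] at hM ⊢
    exact (hG.contr G'.matrix_symm he).congr fun a ha b hb => (hM a ha b hb).symm

theorem WEquiv.reduces_iff {G G' : WGraph} (h : WEquiv G G') {X : List ℤ} :
    Reduces X G.verts G.matrix ↔ Reduces X G'.verts G'.matrix := by
  induction h with
  | rel _ _ h => exact h.elim (fun h => h.reduces_iff) fun h => ⟨h.reduces, h.symm.reduces⟩
  | refl => exact Iff.rfl
  | symm _ _ _ ih => exact ih.symm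
  | trans _ _ _ _ _ ih ih' => exact ih.trans ih'

theorem link_range {n i j : ℕ} (hi : i < n) (hj : j < n) :
    link (List.range n) i j = if i + 1 = j ∨ j + 1 = i then 1 else 0 := by
  have key : ∀ n, link (List.range n) i j =
      if i < n ∧ j < n ∧ (i + 1 = j ∨ j + 1 = i) then 1 else 0 := by
    intro n
    induction n with
    | zero => simp
    | succ n ih =>
      cases n with
      | zero => simp; omega
      | succ m =>
        rw [List.range_succ] at ih
        rw [List.range_succ, List.range_succ, List.append_assoc, List.singleton_append, link_append,
          ih, link_cons_cons, link_singleton]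
        split_ifs <;> omega
  simp [key, hi, hj]

theorem isPath_chainGraph (X : List ℤ) :
    IsPath (chainGraph X).matrix (List.range X.length) := by
  refine ⟨List.nodup_range, fun x hx y hy hxy => ?_⟩
  rw [List.mem_range] at hx hy
  rw [WGraph.matrix_of_ne _ hxy, link_range hx hy]
  simp [chainGraph, hx, hy]

theorem weights_chainGraph (X : List ℤ) :
    weights (chainGraph X).matrix (List.range X.length) = X := by
  apply List.ext_getElem
  · simp [weights]
  · intro i h1 h2
    simp [weights, chainGraph, h2]

theorem seqEquivRev_of_wEquiv {X Y : List ℤ} (h : WEquiv (chainGraph X) (chainGraph Y)) :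
    SeqEquivRev X Y := by
  have hY : Reduces Y (chainGraph Y).verts (chainGraph Y).matrix :=
    .path (List.range Y.length) (by ext; simp [chainGraph]) (isPath_chainGraph Y)
      (by rw [weights_chainGraph]; exact .refl Y)
  simpa [weights_chainGraph] using (h.reduces_iff.2 hY).seqEquivRev (chainGraph X).matrix_symm
    (isPath_chainGraph X) (by ext; simp [chainGraph])

/-- The linear chain on the vertices in the list `s`, with weights given by `w`. -/
def listGraph (s : List ℕ) (w : ℕ → ℤ) : WGraph where
  verts := s.toFinset
  adj := fun x y => decide (x ≠ y ∧ link s x y ≠ 0)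
  symm := by intro x y; simp only [link_comm s x y, ne_comm]
  irrefl := by simp
  adj_mem := by
    intro x y h
    rw [decide_eq_true_eq] at h
    simp only [List.mem_toFinset]
    exact ⟨by_contra fun hx => h.2 (link_of_notMem hx y),
      by_contra fun hy => h.2 (by rw [link_comm, link_of_notMem hy])⟩
  wt := w

theorem listGraph_reverse (s : List ℕ) (w : ℕ → ℤ) : listGraph s.reverse w = listGraph s w := by
  simp only [listGraph, List.toFinset_reverse, link_reverse]

theorem chainGraph_iso_listGraph {s : List ℕ} (hs : s.Nodup) (w : ℕ → ℤ) :
    (chainGraph (s.map w)).Iso (listGraph s w) := by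
  have hmap : s = (List.range s.length).map fun i => s.getD i 0 := by
    apply List.ext_getElem
    · simp
    · intro i h1 h2; simp [h1]
  have hinj : Set.InjOn (fun i => s.getD i 0) {i | i ∈ List.range s.length} := by
    intro i hi j hj hij
    simp only [List.mem_range, Set.mem_ofPred_eq] at hi hj
    simp only [hi, hj, List.getD_eq_getElem] at hij
    exact (hs.getElem_inj_iff).1 hij
  refine ⟨fun i => s.getD i 0, ⟨?_, ?_, ?_⟩, ?_, ?_⟩
  · intro i hi
    simp only [chainGraph, List.length_map, Finset.coe_range, Set.mem_Iio] at hi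
    simp [listGraph, hi]
  · intro i hi j hj
    exact hinj (by simpa [chainGraph] using hi) (by simpa [chainGraph] using hj)
  · intro x hx
    obtain ⟨i, hi, rfl⟩ := List.getElem_of_mem (by simpa [listGraph] using hx)
    exact ⟨i, by simpa [chainGraph] using hi, by simp [hi]⟩
  · intro i hi j hj
    have hi' : i < s.length := by simpa [chainGraph] using hi
    have hj' : j < s.length := by simpa [chainGraph] using hj
    have hne : s.getD i 0 = s.getD j 0 ↔ i = j := hinj.eq_iff (by simpa) (by simpa)
    have hl := link_map hinj (x := i) (y := j) (by simpa) (by simpa)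
    rw [← hmap, link_range hi' hj'] at hl
    simp only [listGraph, chainGraph, hl, ne_eq, hne, List.length_map, decide_eq_decide]
    split_ifs <;> simp <;> omega
  · intro i hi
    have hi' : i < s.length := by simpa [chainGraph] using hi
    simp [listGraph, chainGraph, hi']

theorem wEquiv_chainGraph_reverse (X : List ℤ) : WEquiv (chainGraph X.reverse) (chainGraph X) := by
  have h := weights_chainGraph X
  have h1 := chainGraph_iso_listGraph (List.nodup_range (n := X.length))
    fun i => (chainGraph X).matrix i i
  have h2 := chainGraph_iso_listGraph (List.nodup_reverse.2 (List.nodup_range (n := X.length)))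
    fun i => (chainGraph X).matrix i i
  rw [List.map_reverse, listGraph_reverse] at h2
  rw [show List.map _ _ = X from h] at h1 h2
  exact .trans _ _ _ (.rel _ _ (.inr h2)) (.symm _ _ (.rel _ _ (.inr h1)))

theorem isVertexBlowup_listGraph {v e : ℕ} {t : List ℕ} (he : e ∉ v :: t) {w w' : ℕ → ℤ}
    (hwe : w' e = -1) (hwv : w' v = w v - 1) (hw : ∀ a ∈ v :: t, a ≠ v → w' a = w a) :
    IsVertexBlowup (listGraph (v :: t) w) (listGraph (e :: v :: t) w') v e := by
  refine ⟨by simp [listGraph], by simpa [listGraph] using he, by simp [listGraph], fun a b => ?_,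
    hwe, hwv, fun a ha => hw a (by simpa [listGraph] using ha)⟩
  have hne : e ≠ v := by rintro rfl; simp at he
  have := link_nonneg (v :: t) a b
  simp only [listGraph, decide_eq_true_eq, link_cons_cons]
  split_ifs <;> grind

theorem isEdgeBlowup_listGraph {u v e : ℕ} {p q : List ℕ} (hs : (p ++ u :: v :: q).Nodup)
    (he : e ∉ p ++ u :: v :: q) {w w' : ℕ → ℤ} (hwe : w' e = -1) (hwu : w' u = w u - 1)
    (hwv : w' v = w v - 1) (hw : ∀ a ∈ p ++ u :: v :: q, a ≠ u → a ≠ v → w' a = w a) :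
    IsEdgeBlowup (listGraph (p ++ u :: v :: q) w) (listGraph (p ++ u :: e :: v :: q) w') u v e := by
  have huv : u ≠ v := by rintro rfl; simp [List.nodup_append] at hs
  have hu : u ∉ v :: q := by simp [List.nodup_append] at hs; simp; tauto
  have hv : v ∉ p ++ [u] := by simp [List.nodup_append] at hs ⊢; grind
  have hp := link_of_notMem hv
  have hq := link_of_notMem hu
  refine ⟨?_, fun h => he (List.mem_toFinset.1 h), by ext; simp [listGraph]; tauto, fun a b => ?_,
    hwe, hwu, hwv, fun a ha => hw a (List.mem_toFinset.1 ha)⟩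
  · have h1 := hq v
    have h2 := hp u
    rw [link_comm] at h2
    simp only [listGraph, decide_eq_true_eq]
    rw [link_append p u (v :: q), link_cons_cons, h1, h2]
    simp [huv]
  · have heu : e ≠ u := by rintro rfl; simp at he
    have hev : e ≠ v := by rintro rfl; simp at he
    have h1 := link_nonneg (p ++ [u]) a b
    have h2 := link_nonneg (v :: q) a b
    simp only [listGraph, decide_eq_true_eq]
    rw [link_append p u (v :: q), link_append p u (e :: v :: q)]
    simp only [link_cons_cons]
    by_cases ha : (a = u ∧ b = v) ∨ (a = v ∧ b = u)
    · have h3 : link (p ++ [u]) a b = 0 := by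
        rcases ha with ⟨rfl, rfl⟩ | ⟨rfl, rfl⟩
        · rw [link_comm, hp]
        · exact hp _
      have h4 : link (v :: q) a b = 0 := by
        rcases ha with ⟨rfl, rfl⟩ | ⟨rfl, rfl⟩
        · exact hq _
        · rw [link_comm, hq]
      rw [h3, h4]
      grind
    · grind

theorem isFreeBlowup_listGraph {e : ℕ} {w w' : ℕ → ℤ} (hwe : w' e = -1) :
    IsFreeBlowup (listGraph [] w) (listGraph [e] w') e :=
  ⟨by simp [listGraph], by simp [listGraph], by simp [listGraph], hwe, by simp [listGraph]⟩

theorem SeqBlowup.exists_listGraph {X Y : List ℤ} (h : SeqBlowup X Y) {s : List ℕ} (hs : s.Nodup)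
    {w : ℕ → ℤ} (hX : s.map w = X) :
    ∃ (s' : List ℕ) (w' : ℕ → ℤ), s'.Nodup ∧ s'.map w' = Y ∧
      WBlowup (listGraph s w) (listGraph s' w') := by
  obtain ⟨e, he⟩ := Infinite.exists_notMem_finset s.toFinset
  rw [List.mem_toFinset] at he
  have hleft : ∀ {s : List ℕ} (_ : s.Nodup) (_ : e ∉ s) {x : ℤ} {l : List ℤ}
      (_ : s.map w = x :: l), ∃ (s' : List ℕ) (w' : ℕ → ℤ), s'.Nodup ∧
      s'.map w' = -1 :: (x - 1) :: l ∧ WBlowup (listGraph s w) (listGraph s' w') := by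
    intro s hs he x l hX
    obtain ⟨v, t, rfl, rfl, rfl⟩ := List.map_eq_cons_iff.1 hX
    have hev : e ≠ v := by rintro rfl; simp at he
    have hvt := (List.nodup_cons.1 hs).1
    refine ⟨e :: v :: t, fun a => if a = e then -1 else if a = v then w v - 1 else w a,
      List.nodup_cons.2 ⟨he, hs⟩, ?_,
      .inl ⟨v, e, isVertexBlowup_listGraph he (by simp) (by simp [hev.symm]) ?_⟩⟩
    · simp only [List.map_cons, if_true, hev.symm, if_false]
      refine congrArg _ (congrArg _ (List.map_congr_left fun a ha => ?_))
      rw [if_neg, if_neg]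
      · rintro rfl; exact hvt ha
      · rintro rfl; simp [ha] at he
    · intro a ha hav
      rw [if_neg, if_neg hav]
      rintro rfl; exact he ha
  cases h with
  | empty =>
    obtain rfl := List.map_eq_nil_iff.1 hX
    exact ⟨[0], fun _ => -1, by simp, by simp, .inr (.inr ⟨0, isFreeBlowup_listGraph rfl⟩)⟩
  | left x l => exact hleft hs he hX
  | right l x =>
    obtain ⟨s', w', h1, h2, h3⟩ := hleft (s := s.reverse) (x := x) (l := l.reverse)
      (by simpa using hs) (by simpa using he) (by simp [List.map_reverse, hX])
    refine ⟨s'.reverse, w', by simpa using h1, by simp [List.map_reverse, h2], ?_⟩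
    rwa [listGraph_reverse] at h3 ⊢
  | mid A B a b =>
    obtain ⟨p, r, rfl, rfl, hr⟩ := List.map_eq_append_iff.1 hX
    obtain ⟨u, r, rfl, rfl, hr'⟩ := List.map_eq_cons_iff.1 hr
    obtain ⟨v, q, rfl, rfl, rfl⟩ := List.map_eq_cons_iff.1 hr'
    have heu : e ≠ u := by rintro rfl; simp at he
    have hev : e ≠ v := by rintro rfl; simp at he
    have huv : u ≠ v := by rintro rfl; simp [List.nodup_append] at hs
    set w' : ℕ → ℤ := fun a => if a = e then -1 else if a = u ∨ a = v then w a - 1 else w a with hw'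
    have hww : ∀ a ∈ p ++ u :: v :: q, a ≠ u → a ≠ v → w' a = w a := fun a ha hau hav => by
      have : a ≠ e := by rintro rfl; exact he ha
      simp [hw', this, hau, hav]
    have hwe : w' e = -1 := by simp [hw']
    have hwu : w' u = w u - 1 := by simp [hw', heu.symm]
    have hwv : w' v = w v - 1 := by simp [hw', hev.symm]
    refine ⟨p ++ u :: e :: v :: q, w', ?_, ?_,
      .inr (.inl ⟨u, v, e, isEdgeBlowup_listGraph hs he hwe hwu hwv hww⟩)⟩
    · simp [List.nodup_append] at hs he ⊢; grind
    · have hp : p.map w' = p.map w := List.map_congr_left fun a ha => hww a (by simp [ha])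
        (by rintro rfl; simp [List.nodup_append] at hs; grind)
        (by rintro rfl; simp [List.nodup_append] at hs; grind)
      have hq : q.map w' = q.map w := List.map_congr_left fun a ha => hww a (by simp [ha])
        (by rintro rfl; simp [List.nodup_append] at hs; grind)
        (by rintro rfl; simp [List.nodup_append] at hs; grind)
      simp [hp, hq, hwe, hwu, hwv]

theorem SeqEquiv.wEquiv {X Y : List ℤ} (h : SeqEquiv X Y) :
    WEquiv (chainGraph X) (chainGraph Y) := by
  induction h with
  | rel X Y h =>
    have hX := chainGraph_iso_listGraph (List.nodup_range (n := X.length))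
      fun i => (chainGraph X).matrix i i
    obtain ⟨s', w', hs', rfl, hb⟩ := h.exists_listGraph List.nodup_range (weights_chainGraph X)
    rw [show List.map _ _ = X from weights_chainGraph X] at hX
    exact .trans _ _ _ (.trans _ _ _ (.rel _ _ (.inr hX)) (.rel _ _ (.inl hb)))
      (.symm _ _ (.rel _ _ (.inr (chainGraph_iso_listGraph hs' w'))))
  | refl => exact .refl _
  | symm _ _ _ ih => exact .symm _ _ ih
  | trans _ _ _ _ _ ih ih' => exact .trans _ _ _ ih ih'

/-- **Lemma.** (1) `X ~ Y` iff `X⁻ ~ Y⁻`; (2) `[X] ~ [Y]` (as weighted graphs) iff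
`X ~ Y` or `X ~ Y⁻`. -/
theorem seqEquiv_reverse_and_chain_equiv (X Y : List ℤ) :
    (SeqEquiv X Y ↔ SeqEquiv X.reverse Y.reverse) ∧
    (WEquiv (chainGraph X) (chainGraph Y) ↔ (SeqEquiv X Y ∨ SeqEquiv X Y.reverse)) := by
  refine ⟨seqEquiv_reverse_iff, seqEquivRev_of_wEquiv, fun h => ?_⟩
  rcases h with h | h
  · exact h.wEquiv
  · exact .trans _ _ _ h.wEquiv (wEquiv_chainGraph_reverse Y)
end

section
/- If X, Y ∈ ℤ* satisfy X ~ Y, then det(X) = det(Y) and hodge(X) = hodge(Y). -/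
/-- The determinant of the matrix `-M(X)`, where `M(X)` is the intersection matrix of
the sequence `X` (diagonal `xᵢ`, `1` on the off-diagonals `|i-j| = 1`); `det(∅) = 1`. -/
def seqDet : List ℤ → ℤ
  | [] => 1
  | [x] => -x
  | x :: y :: l => -x * seqDet (y :: l) - seqDet l

/-- `det₁(x₁,…,xₙ) = det(x₂,…,xₙ)`, with `det₁(∅) = 0`. -/
def seqDet1 : List ℤ → ℤ
  | [] => 0
  | _ :: l => seqDet l

/-- The intersection form of the sequence `X`: the symmetric bilinear form on `ℝⁿ`
(`n = length of X`) whose matrix has `xᵢ` on the diagonal and `1` in positions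
`(i,j)` with `|i-j| = 1`, evaluated at `(v, v)`. -/
noncomputable def seqForm (X : List ℤ) (v : Fin X.length → ℝ) : ℝ :=
  ∑ i, ∑ j, v i * (if i = j then ((X.get i : ℤ) : ℝ)
    else if i.val + 1 = j.val ∨ j.val + 1 = i.val then 1 else 0) * v j

/-- `hodge(X)`: the maximal dimension of a linear subspace of `ℝⁿ` on which the
intersection form of `X` is nonnegative. -/
noncomputable def seqHodge (X : List ℤ) : ℕ :=
  sSup { k | ∃ W : Submodule ℝ (Fin X.length → ℝ),
      Module.finrank ℝ W = k ∧ ∀ v ∈ W, 0 ≤ seqForm X v }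

theorem seqDet_cons (x : ℤ) (l : List ℤ) :
    seqDet (x :: l) = -x * seqDet l - seqDet1 l := by
  cases l <;> simp [seqDet, seqDet1]

theorem seqDet_append_congr {P Q : List ℤ} (h : seqDet P = seqDet Q)
    (h₁ : seqDet1 P = seqDet1 Q) (A : List ℤ) :
    seqDet (A ++ P) = seqDet (A ++ Q) ∧ seqDet1 (A ++ P) = seqDet1 (A ++ Q) := by
  induction A with
  | nil => exact ⟨h, h₁⟩
  | cons a A ih =>
    refine ⟨?_, ih.1⟩
    rw [List.cons_append, List.cons_append, seqDet_cons, seqDet_cons, ih.1, ih.2]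

theorem SeqBlowup.seqDet_eq {X Y : List ℤ} (h : SeqBlowup X Y) : seqDet X = seqDet Y := by
  cases h with
  | empty => simp [seqDet]
  | left x l =>
    simp only [seqDet_cons, seqDet1]
    ring
  | mid A B a b =>
    refine (seqDet_append_congr ?_ ?_ A).1 <;> simp only [seqDet_cons, seqDet1] <;> ring
  | right l x =>
    refine (seqDet_append_congr ?_ ?_ l).1 <;> simp [seqDet, seqDet1]

/-- The intersection form of a sequence, evaluated recursively on a function `ℕ → ℝ`. It agrees
with `seqForm` on functions that vanish beyond the length of the sequence. -/
noncomputable def seqQuad : List ℤ → (ℕ → ℝ) → ℝ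
  | [], _ => 0
  | x :: l, f => x * f 0 ^ 2 + 2 * f 0 * f 1 + seqQuad l (fun i => f (i + 1))

/-- Extension by zero of a vector to a function on `ℕ`. -/
def zeroExtend (n : ℕ) : (Fin n → ℝ) →ₗ[ℝ] (ℕ → ℝ) where
  toFun v i := if h : i < n then v ⟨i, h⟩ else 0
  map_add' v w := by ext i; by_cases h : i < n <;> simp [h]
  map_smul' c v := by ext i; by_cases h : i < n <;> simp [h]

theorem zeroExtend_apply {n : ℕ} (v : Fin n → ℝ) (i : ℕ) :
    zeroExtend n v i = if h : i < n then v ⟨i, h⟩ else 0 := rfl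

theorem zeroExtend_of_le {n : ℕ} (v : Fin n → ℝ) {i : ℕ} (hi : n ≤ i) :
    zeroExtend n v i = 0 := by
  simp [zeroExtend_apply, hi.not_gt]

theorem zeroExtend_injective (n : ℕ) : Function.Injective (zeroExtend n) := by
  intro v w h
  ext i
  simpa [zeroExtend_apply] using congrFun h i

theorem zeroExtend_funLeft {n : ℕ} {f : ℕ → ℝ} (hf : ∀ i, n ≤ i → f i = 0) :
    zeroExtend n (LinearMap.funLeft ℝ ℝ (Fin.val : Fin n → ℕ) f) = f := by
  ext i
  by_cases h : i < n
  · simp [zeroExtend_apply, h, LinearMap.funLeft_apply]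
  · simp [zeroExtend_apply, h, hf i (not_lt.1 h)]

theorem seqForm_eq_seqQuad (X : List ℤ) (v : Fin X.length → ℝ) :
    seqForm X v = seqQuad X (zeroExtend X.length v) := by
  induction X with
  | nil => simp [seqForm, seqQuad]
  | cons x l ih =>
    have htail : (fun i => zeroExtend (x :: l).length v (i + 1)) =
        zeroExtend l.length (fun i => v i.succ) := by
      ext i
      simp [zeroExtend_apply, Fin.succ]
    have hrow : ∑ j : Fin l.length, v 0 * (if (0 : ℕ) + 1 = (j.succ : ℕ) ∨
        (j.succ : ℕ) + 1 = 0 then (1 : ℝ) else 0) * v j.succ =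
        v 0 * zeroExtend (x :: l).length v 1 := by
      cases l with
      | nil => simp [zeroExtend_apply]
      | cons y l => simp [zeroExtend_apply]
    have hcol : ∑ j : Fin l.length, v j.succ * (if (j.succ : ℕ) + 1 = 0 ∨
        (0 : ℕ) + 1 = (j.succ : ℕ) then (1 : ℝ) else 0) * v 0 =
        v 0 * zeroExtend (x :: l).length v 1 := by
      rw [← hrow]
      refine Finset.sum_congr rfl fun j _ => ?_
      simp only [or_comm]
      ring
    have h0 : zeroExtend (x :: l).length v 0 = v 0 := by simp [zeroExtend_apply]
    rw [seqQuad, htail, ← ih, h0]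
    have key : seqForm (x :: l) v = (v 0 * (x : ℝ) * v 0 +
        ∑ j : Fin l.length, v 0 * (if (0 : ℕ) + 1 = (j.succ : ℕ) ∨
          (j.succ : ℕ) + 1 = 0 then (1 : ℝ) else 0) * v j.succ) +
        (∑ j : Fin l.length, v j.succ * (if (j.succ : ℕ) + 1 = 0 ∨
          (0 : ℕ) + 1 = (j.succ : ℕ) then (1 : ℝ) else 0) * v 0 +
        seqForm l (fun i => v i.succ)) := by
      unfold seqForm
      simp only [List.length_cons]
      rw [Fin.sum_univ_succ, Fin.sum_univ_succ, ← Finset.sum_add_distrib]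
      congr 1
      refine Finset.sum_congr rfl fun i _ => ?_
      rw [Fin.sum_univ_succ]
      congr 1
      refine Finset.sum_congr rfl fun j _ => ?_
      simp [Fin.succ_inj]
    rw [key, hrow, hcol]
    ring

/-- Deleting the `k`-th coordinate. -/
def deleteCoord (k : ℕ) : (ℕ → ℝ) →ₗ[ℝ] (ℕ → ℝ) :=
  LinearMap.funLeft ℝ ℝ (fun i => if i < k then i else i + 1)

theorem deleteCoord_apply (k : ℕ) (g : ℕ → ℝ) (i : ℕ) :
    deleteCoord k g i = g (if i < k then i else i + 1) := rfl

/-- Inserting the value `φ u` as `k`-th coordinate of `u`. -/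
def insertCoord (k : ℕ) (φ : (ℕ → ℝ) →ₗ[ℝ] ℝ) : (ℕ → ℝ) →ₗ[ℝ] (ℕ → ℝ) where
  toFun u i := if i < k then u i else if i = k then φ u else u (i - 1)
  map_add' u w := by ext i; simp only [Pi.add_apply, map_add]; split_ifs <;> rfl
  map_smul' c u := by ext i; simp only [Pi.smul_apply, map_smul, RingHom.id_apply]; split_ifs <;> rfl

theorem insertCoord_apply (k : ℕ) (φ : (ℕ → ℝ) →ₗ[ℝ] ℝ) (u : ℕ → ℝ) (i : ℕ) :
    insertCoord k φ u i = if i < k then u i else if i = k then φ u else u (i - 1) := rfl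

theorem deleteCoord_insertCoord (k : ℕ) (φ : (ℕ → ℝ) →ₗ[ℝ] ℝ) (u : ℕ → ℝ) :
    deleteCoord k (insertCoord k φ u) = u := by
  ext i
  rw [deleteCoord_apply, insertCoord_apply]
  by_cases h : i < k
  · simp [h]
  · have h₁ : ¬ i + 1 < k := by omega
    have h₂ : i + 1 ≠ k := by omega
    simp [h, h₁, h₂]

/-- A function with a vanishing `k`-th coordinate and vanishing other coordinates is zero. -/
theorem eq_zero_of_deleteCoord_eq_zero {k : ℕ} {g : ℕ → ℝ} (h : deleteCoord k g = 0)
    (hk : g k = 0) : g = 0 := by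
  ext i
  rcases lt_trichotomy i k with hi | rfl | hi
  · simpa [deleteCoord_apply, hi] using congrFun h i
  · exact hk
  · have h₁ : ¬ i - 1 < k := by omega
    have h₂ : i - 1 + 1 = i := by omega
    simpa [deleteCoord_apply, h₁, h₂] using congrFun h (i - 1)

/-- Up to the linear change of the `k`-th coordinate given by `φ`, the form of `Y` is the
orthogonal sum of the form of `X` and the negative definite form of rank one. -/
def IsNegStabilization (X Y : List ℤ) (k : ℕ) (φ : (ℕ → ℝ) →ₗ[ℝ] ℝ) : Prop :=
  ∀ g : ℕ → ℝ, (∀ i, Y.length ≤ i → g i = 0) →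
    seqQuad Y g = seqQuad X (deleteCoord k g) - (g k - φ (deleteCoord k g)) ^ 2

theorem IsNegStabilization.seqHodge_eq {X Y : List ℤ} {k : ℕ} {φ : (ℕ → ℝ) →ₗ[ℝ] ℝ}
    (h : IsNegStabilization X Y k φ) (hk : k ≤ X.length) (hlen : Y.length = X.length + 1) :
    seqHodge X = seqHodge Y := by
  set restrict : (n : ℕ) → (ℕ → ℝ) →ₗ[ℝ] (Fin n → ℝ) :=
    fun n => LinearMap.funLeft ℝ ℝ (Fin.val : Fin n → ℕ)
  have hdel (v : Fin Y.length → ℝ) : zeroExtend X.length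
      (restrict X.length (deleteCoord k (zeroExtend Y.length v))) =
      deleteCoord k (zeroExtend Y.length v) := by
    refine zeroExtend_funLeft fun i hi => ?_
    rw [deleteCoord_apply, if_neg (by omega), zeroExtend_of_le _ (by omega)]
  have hins (v : Fin X.length → ℝ) : zeroExtend Y.length
      (restrict Y.length (insertCoord k φ (zeroExtend X.length v))) =
      insertCoord k φ (zeroExtend X.length v) := by
    refine zeroExtend_funLeft fun i hi => ?_
    rw [insertCoord_apply, if_neg (by omega), if_neg (by omega), zeroExtend_of_le _ (by omega)]
  unfold seqHodge
  congr 1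
  ext d
  constructor
  · rintro ⟨W, rfl, hW⟩
    set s : (Fin X.length → ℝ) →ₗ[ℝ] (Fin Y.length → ℝ) :=
      restrict Y.length ∘ₗ insertCoord k φ ∘ₗ zeroExtend X.length
    have hs_ext (v : Fin X.length → ℝ) : zeroExtend Y.length (s v) =
      insertCoord k φ (zeroExtend X.length v) := hins v
    have hs_inj : Function.Injective s := by
      intro v w hvw
      apply zeroExtend_injective
      rw [← deleteCoord_insertCoord k φ (zeroExtend _ v), ← hs_ext, hvw, hs_ext,
        deleteCoord_insertCoord]
    refine ⟨W.map s, (Submodule.equivMapOfInjective s hs_inj W).finrank_eq.symm, ?_⟩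
    rintro _ ⟨v, hv, rfl⟩
    have hsk : insertCoord k φ (zeroExtend X.length v) k = φ (zeroExtend X.length v) := by
      simp [insertCoord_apply]
    rw [seqForm_eq_seqQuad, h _ fun i hi => zeroExtend_of_le _ hi, hs_ext,
      deleteCoord_insertCoord, hsk, sub_self, zero_pow two_ne_zero, sub_zero,
      ← seqForm_eq_seqQuad]
    exact hW v hv
  · rintro ⟨W, rfl, hW⟩
    set p : (Fin Y.length → ℝ) →ₗ[ℝ] (Fin X.length → ℝ) :=
      restrict X.length ∘ₗ deleteCoord k ∘ₗ zeroExtend Y.length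
    have hp_ext (v : Fin Y.length → ℝ) : zeroExtend X.length (p v) =
      deleteCoord k (zeroExtend Y.length v) := hdel v
    have hform (v : Fin Y.length → ℝ) : seqForm Y v = seqForm X (p v) -
        (zeroExtend Y.length v k - φ (deleteCoord k (zeroExtend Y.length v))) ^ 2 := by
      rw [seqForm_eq_seqQuad, seqForm_eq_seqQuad, hp_ext,
        h _ fun i hi => zeroExtend_of_le _ hi]
    have hp_inj : Function.Injective (p.domRestrict W) := by
      rw [← LinearMap.ker_eq_bot, LinearMap.ker_eq_bot']
      rintro ⟨v, hv⟩ hpv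
      replace hpv : p v = 0 := hpv
      have hd : deleteCoord k (zeroExtend Y.length v) = 0 := by rw [← hp_ext, hpv, map_zero]
      have hnonneg := hW v hv
      rw [hform, hpv, hd, map_zero, sub_zero] at hnonneg
      have hzero : seqForm X 0 = 0 := by simp [seqForm]
      have hvk : zeroExtend Y.length v k = 0 := by
        rw [hzero] at hnonneg
        nlinarith [sq_nonneg (zeroExtend Y.length v k)]
      have hv0 : v = 0 := by
        apply zeroExtend_injective
        rw [eq_zero_of_deleteCoord_eq_zero hd hvk, map_zero]
      exact Subtype.ext hv0
    refine ⟨LinearMap.range (p.domRestrict W), LinearMap.finrank_range_of_inj hp_inj, ?_⟩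
    rintro _ ⟨⟨v, hv⟩, rfl⟩
    have hnonneg := hW v hv
    rw [hform] at hnonneg
    have hsq := sq_nonneg
      (zeroExtend Y.length v k - φ (deleteCoord k (zeroExtend Y.length v)))
    change 0 ≤ seqForm X (p v)
    linarith

theorem IsNegStabilization.cons {X Y : List ℤ} {k : ℕ} {φ : (ℕ → ℝ) →ₗ[ℝ] ℝ}
    (h : IsNegStabilization X Y (k + 1) φ) (x : ℤ) :
    IsNegStabilization (x :: X) (x :: Y) (k + 2) (φ ∘ₗ LinearMap.funLeft ℝ ℝ Nat.succ) := by
  intro g hg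
  have htail : (fun i => deleteCoord (k + 2) g (i + 1)) =
      deleteCoord (k + 1) (fun i => g (i + 1)) := by
    ext i
    simp only [deleteCoord_apply]
    split_ifs <;> first | rfl | omega
  have hφ : (φ ∘ₗ LinearMap.funLeft ℝ ℝ Nat.succ) (deleteCoord (k + 2) g) =
      φ (deleteCoord (k + 1) (fun i => g (i + 1))) := congrArg φ htail
  have h0 : deleteCoord (k + 2) g 0 = g 0 := by simp [deleteCoord_apply]
  have h1 : deleteCoord (k + 2) g 1 = g 1 := by simp [deleteCoord_apply]
  rw [hφ, seqQuad, seqQuad, htail, h0, h1, h (fun i => g (i + 1)) fun i hi => hg _ (by simpa)]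
  ring

theorem IsNegStabilization.append {P Q : List ℤ} {φ : (ℕ → ℝ) →ₗ[ℝ] ℝ}
    (h : IsNegStabilization P Q 1 φ) (A : List ℤ) :
    ∃ ψ, IsNegStabilization (A ++ P) (A ++ Q) (A.length + 1) ψ := by
  induction A with
  | nil => exact ⟨φ, h⟩
  | cons a A ih =>
    obtain ⟨ψ, hψ⟩ := ih
    exact ⟨_, hψ.cons a⟩

theorem SeqBlowup.seqHodge_eq {X Y : List ℤ} (h : SeqBlowup X Y) :
    seqHodge X = seqHodge Y := by
  cases h with
  | empty =>
    have h : IsNegStabilization [] [-1] 0 0 := by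
      intro g hg
      simp [seqQuad, hg 1]
    exact h.seqHodge_eq le_rfl rfl
  | left x l =>
    have h : IsNegStabilization (x :: l) (-1 :: (x - 1) :: l) 0 (LinearMap.proj 0) := by
      intro g hg
      simp only [seqQuad, deleteCoord_apply, LinearMap.proj_apply]
      push_cast
      simp
      ring
    exact h.seqHodge_eq (Nat.zero_le _) rfl
  | mid A B a b =>
    have h : IsNegStabilization (a :: b :: B) ((a - 1) :: -1 :: (b - 1) :: B) 1
        (LinearMap.proj (R := ℝ) (φ := fun _ => ℝ) 0 +
          LinearMap.proj (R := ℝ) (φ := fun _ => ℝ) 1) := by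
      intro g hg
      simp only [seqQuad, deleteCoord_apply, LinearMap.add_apply, LinearMap.proj_apply]
      push_cast
      simp
      ring
    obtain ⟨ψ, hψ⟩ := h.append A
    exact hψ.seqHodge_eq (by simp) (by simp; omega)
  | right l x =>
    have h : IsNegStabilization [x] [x - 1, -1] 1 (LinearMap.proj 0) := by
      intro g hg
      have h2 : g 2 = 0 := hg 2 le_rfl
      simp [seqQuad, deleteCoord_apply, h2]
      ring
    obtain ⟨ψ, hψ⟩ := h.append l
    exact hψ.seqHodge_eq (by simp) (by simp)

/-- **Lemma.** Equivalent sequences have the same determinant and the same hodge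
invariant. -/
theorem seqEquiv_det_hodge (X Y : List ℤ) (h : SeqEquiv X Y) :
    seqDet X = seqDet Y ∧ seqHodge X = seqHodge Y := by
  induction h with
  | rel X Y h => exact ⟨h.seqDet_eq, h.seqHodge_eq⟩
  | refl X => exact ⟨rfl, rfl⟩
  | symm X Y _ ih => exact ⟨ih.1.symm, ih.2.symm⟩
  | trans X Y Z _ _ ih₁ ih₂ => exact ⟨ih₁.1.trans ih₂.1, ih₁.2.trans ih₂.2⟩
end

section
/- For every i ∈ ℕ and every A ∈ ℤ*: hodge(0^{2i}, A) = i + hodge(A). -/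
/-- The subspaces counted by `seqHodge X` have dimension at most `seqHodge X`. -/
theorem finrank_le_seqHodge {X : List ℤ} (W : Submodule ℝ (Fin X.length → ℝ))
    (hW : ∀ v ∈ W, 0 ≤ seqForm X v) : Module.finrank ℝ W ≤ seqHodge X := by
  refine le_csSup ⟨Module.finrank ℝ (Fin X.length → ℝ), ?_⟩ ⟨W, rfl, hW⟩
  rintro k ⟨V, rfl, -⟩
  exact V.finrank_le

/-- The supremum in the definition of `seqHodge X` is attained. -/
theorem exists_finrank_eq_seqHodge (X : List ℤ) :
    ∃ W : Submodule ℝ (Fin X.length → ℝ),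
      Module.finrank ℝ W = seqHodge X ∧ ∀ v ∈ W, 0 ≤ seqForm X v := by
  refine Nat.sSup_mem (s := { k | ∃ W : Submodule ℝ (Fin X.length → ℝ),
      Module.finrank ℝ W = k ∧ ∀ v ∈ W, 0 ≤ seqForm X v }) ⟨0, ⊥, finrank_bot ℝ _, ?_⟩
    ⟨Module.finrank ℝ (Fin X.length → ℝ), ?_⟩
  · rintro v hv
    rw [Submodule.mem_bot] at hv
    simp [hv, seqForm]
  · rintro k ⟨V, rfl, -⟩
    exact V.finrank_le

/-- The first coordinate as a linear functional, zero when there are no coordinates. -/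
noncomputable def headCoord (n : ℕ) : (Fin n → ℝ) →ₗ[ℝ] ℝ :=
  ∑ j : Fin n, (if j.val = 0 then 1 else 0 : ℝ) • LinearMap.proj j

theorem seqForm_cons (a : ℤ) (X : List ℤ) (x : ℝ) (v : Fin X.length → ℝ) :
    seqForm (a :: X) (Fin.cons x v : Fin (X.length + 1) → ℝ) =
      a * x ^ 2 + 2 * x * headCoord X.length v + seqForm X v := by
  have key : ∀ w : Fin (X.length + 1) → ℝ, seqForm (a :: X) w =
      ∑ i : Fin (X.length + 1), ∑ j : Fin (X.length + 1),
        w i * (if i = j then (((a :: X).get i : ℤ) : ℝ)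
          else if i.val + 1 = j.val ∨ j.val + 1 = i.val then 1 else 0) * w j := fun _ => rfl
  rw [key]
  simp only [Fin.sum_univ_succ, Fin.cons_zero, Fin.cons_succ, Fin.succ_inj, Fin.val_succ,
    Fin.val_zero, Finset.sum_add_distrib, seqForm, headCoord, LinearMap.sum_apply,
    LinearMap.smul_apply, LinearMap.proj_apply, smul_eq_mul, Finset.mul_sum,
    Fin.succ_ne_zero, (Fin.succ_ne_zero _).symm, if_false, if_true, List.get_cons_zero,
    List.get_cons_succ', add_left_inj]
  have h1 : ∀ j : ℕ, (0 = j ∨ j + 1 + 1 = 0) ↔ j = 0 := by lia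
  have h2 : ∀ j : ℕ, (j + 1 + 1 = 0 ∨ 0 = j) ↔ j = 0 := by lia
  have h3 : ∀ j : Fin X.length, v j * ((if j.val = 0 then 1 else 0) * x) =
      x * ((if j.val = 0 then 1 else 0) * v j) := fun j => by ring
  simp only [h1, h2, h3, mul_assoc, ← Finset.mul_sum]
  ring

theorem headCoord_cons (n : ℕ) (x : ℝ) (v : Fin n → ℝ) :
    headCoord (n + 1) (Fin.cons x v : Fin (n + 1) → ℝ) = x := by
  simp [headCoord]

/-- The form of `(0, 0, A)` is that of `A` plus a hyperbolic plane, up to a shear. -/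
theorem seqForm_zero_zero_cons (A : List ℤ) (x y : ℝ) (v : Fin A.length → ℝ) :
    seqForm (0 :: 0 :: A)
        (Fin.cons x (Fin.cons y v : Fin (A.length + 1) → ℝ) : Fin (A.length + 1 + 1) → ℝ) =
      2 * y * (x + headCoord A.length v) + seqForm A v := by
  have h := seqForm_cons 0 (0 :: A) x (Fin.cons y v : Fin (A.length + 1) → ℝ)
  have h' := headCoord_cons A.length y v
  simp only [List.length_cons] at h
  rw [h, h', seqForm_cons]
  push_cast
  ring

theorem le_seqHodge_zero_zero_cons (A : List ℤ) : 1 + seqHodge A ≤ seqHodge (0 :: 0 :: A) := by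
  obtain ⟨U, hU, hpos⟩ := exists_finrank_eq_seqHodge A
  let S : ℝ × U →ₗ[ℝ] (Fin (A.length + 1 + 1) → ℝ) :=
    { toFun := fun p => Fin.cons (p.1 - headCoord A.length p.2)
        (Fin.cons 0 (p.2 : Fin A.length → ℝ) : Fin (A.length + 1) → ℝ)
      map_add' := fun p q => by
        funext j
        refine Fin.cases ?_ (fun j => Fin.cases ?_ (fun j => ?_) j) j <;> simp
        ring
      map_smul' := fun c p => by
        funext j
        refine Fin.cases ?_ (fun j => Fin.cases ?_ (fun j => ?_) j) j <;> simp
        ring }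
  have hS : Function.Injective S := by
    rintro ⟨t, u⟩ ⟨t', u'⟩ h
    obtain rfl : u = u' := Subtype.ext (funext fun j => congrFun h j.succ.succ)
    exact Prod.ext (sub_left_injective (congrFun h 0)) rfl
  have hdim : Module.finrank ℝ (LinearMap.range S) = 1 + seqHodge A := by
    rw [LinearMap.finrank_range_of_inj hS, Module.finrank_prod, hU, Module.finrank_self]
  rw [← hdim]
  refine finrank_le_seqHodge (X := 0 :: 0 :: A) (LinearMap.range S) ?_
  rintro _ ⟨⟨t, u⟩, rfl⟩
  refine le_of_le_of_eq (hpos u u.2)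
    ((seqForm_zero_zero_cons A (t - headCoord A.length u) 0 u).trans ?_).symm
  ring

theorem seqHodge_zero_zero_cons_le (A : List ℤ) : seqHodge (0 :: 0 :: A) ≤ 1 + seqHodge A := by
  obtain ⟨W, hW, hpos⟩ : ∃ W : Submodule ℝ (Fin (A.length + 1 + 1) → ℝ),
      Module.finrank ℝ W = seqHodge (0 :: 0 :: A) ∧ ∀ v ∈ W, 0 ≤ seqForm (0 :: 0 :: A) v :=
    exists_finrank_eq_seqHodge (0 :: 0 :: A)
  let T : (Fin (A.length + 1 + 1) → ℝ) →ₗ[ℝ] (Fin A.length → ℝ) :=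
    LinearMap.funLeft ℝ ℝ fun j => j.succ.succ
  let f : (Fin (A.length + 1 + 1) → ℝ) →ₗ[ℝ] ℝ :=
    LinearMap.proj 0 + headCoord A.length ∘ₗ T + LinearMap.proj 1
  have hform : ∀ w ∈ W, f w = 0 → 2 * w 1 ^ 2 ≤ seqForm A (T w) := by
    intro w hw hf
    have hcons : (Fin.cons (w 0) (Fin.cons (w 1) (T w) : Fin (A.length + 1) → ℝ) :
        Fin (A.length + 1 + 1) → ℝ) = w := by
      funext j
      refine Fin.cases ?_ (fun j => Fin.cases ?_ (fun j => ?_) j) j <;> rfl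
    have h := seqForm_zero_zero_cons A (w 0) (w 1) (T w)
    rw [hcons] at h
    have hx : w 0 + headCoord A.length (T w) = -w 1 := eq_neg_of_add_eq_zero_left hf
    have h0 : 0 ≤ 2 * w 1 * (w 0 + headCoord A.length (T w)) + seqForm A (T w) :=
      h ▸ hpos w hw
    rw [hx] at h0
    linarith
  let K := LinearMap.ker (f ∘ₗ W.subtype)
  let g : K →ₗ[ℝ] (Fin A.length → ℝ) := T ∘ₗ W.subtype ∘ₗ K.subtype
  have hg : Function.Injective g := by
    rintro ⟨⟨a, ha⟩, hfa⟩ ⟨⟨b, hb⟩, hfb⟩ hab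
    refine Subtype.ext (Subtype.ext (sub_eq_zero.1 ?_))
    change f a = 0 at hfa
    change f b = 0 at hfb
    change T a = T b at hab
    change a - b = 0
    have hw := W.sub_mem ha hb
    have hf : f (a - b) = 0 := by rw [map_sub, hfa, hfb, sub_zero]
    have hT : T (a - b) = 0 := by rw [map_sub, hab, sub_self]
    generalize a - b = w at *
    have h := hform w hw hf
    rw [hT] at h
    have h1 : w 1 = 0 := by
      have : seqForm A 0 = 0 := by simp [seqForm]
      rw [this] at h
      exact pow_eq_zero_iff two_ne_zero |>.1 (by nlinarith [sq_nonneg (w 1)])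
    have h0 : w 0 = 0 := by
      have : w 0 + headCoord A.length (T w) + w 1 = 0 := hf
      simpa [hT, h1] using this
    funext j
    exact Fin.cases h0 (fun j => Fin.cases h1 (fun j => congrFun hT j) j) j
  have hK : Module.finrank ℝ K ≤ seqHodge A := by
    rw [← LinearMap.finrank_range_of_inj hg]
    refine finrank_le_seqHodge _ ?_
    rintro _ ⟨⟨⟨w, hw⟩, hf⟩, rfl⟩
    exact le_trans (by positivity) (hform w hw hf)
  have hrank := LinearMap.finrank_range_add_finrank_ker (f ∘ₗ W.subtype)
  have hrange := (LinearMap.range (f ∘ₗ W.subtype)).finrank_le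
  rw [Module.finrank_self] at hrange
  rw [← hW]
  exact hrank ▸ add_le_add hrange hK

theorem seqHodge_zero_zero_cons (A : List ℤ) : seqHodge (0 :: 0 :: A) = 1 + seqHodge A :=
  (seqHodge_zero_zero_cons_le A).antisymm (le_seqHodge_zero_zero_cons A)

/-- **Lemma.** `hodge(0^{2i}, A) = i + hodge(A)`. -/
theorem hodge_replicate_zero (i : ℕ) (A : List ℤ) :
    seqHodge (List.replicate (2 * i) 0 ++ A) = i + seqHodge A := by
  induction i with
  | zero => simp
  | succ i ih =>
    rw [Nat.mul_succ, List.replicate_succ, List.replicate_succ, List.cons_append,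
      List.cons_append, seqHodge_zero_zero_cons, ih]
    ring
end
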